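/- For every finite set P ⊂ ℝ² of n ≥ 3 points there exists a threshold α₀ ∈ (0,π) such that for all α ∈ (0,α₀): every plane α-bend graph on P has at most 3n−6 edges and there exists one with exactly 3n−6 edges, and every plane α-bend multigraph on P has at most 4n−6 edges and there exists one with exactly 4n−6 edges. -/

import Mathlib

open EuclideanGeometry Real Set

noncomputable section

/-- The Euclidean plane. -/
abbrev Pt : Type := EuclideanSpace ℝ (Fin 2)

/-- The image of a one-bend edge `(a,b,c)`: the union of segments `[a,b]` and `[b,c]`. -/
def bendImage (e : Pt × Pt × Pt) : Set Pt :=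
  segment ℝ e.1 e.2.1 ∪ segment ℝ e.2.1 e.2.2

/-- The endpoints of a (bend or arc) edge `(a,b,c)` are `a` and `c`. -/
def edgeEndpoints (e : Pt × Pt × Pt) : Set Pt := {e.1, e.2.2}

/-- An `α`-bend edge: a triple `(a,b,c)` with `a ≠ c` and angle `α` at `b`. -/
def IsBendEdge (α : ℝ) (e : Pt × Pt × Pt) : Prop :=
  e.1 ≠ e.2.2 ∧ ∠ e.1 e.2.1 e.2.2 = α

/-- A plane `α`-bend multigraph on a finite vertex set `V`. -/
def IsPlaneBendMultigraph (α : ℝ) (V : Finset Pt) (E : Finset (Pt × Pt × Pt)) : Prop :=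
  (∀ e ∈ E, IsBendEdge α e ∧ e.1 ∈ V ∧ e.2.2 ∈ V) ∧
  (∀ e ∈ E, ∀ f ∈ E, e ≠ f → bendImage e ≠ bendImage f) ∧
  (∀ e ∈ E, ∀ v ∈ V, (v : Pt) ∈ bendImage e → (v : Pt) ∈ edgeEndpoints e) ∧
  (∀ e ∈ E, ∀ f ∈ E, e ≠ f →
    bendImage e ∩ bendImage f ⊆ edgeEndpoints e ∩ edgeEndpoints f)

/-- A plane `α`-bend graph: a plane `α`-bend multigraph in which distinct edges
have distinct endpoint pairs. -/
def IsPlaneBendGraph (α : ℝ) (V : Finset Pt) (E : Finset (Pt × Pt × Pt)) : Prop :=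
  IsPlaneBendMultigraph α V E ∧
  ∀ e ∈ E, ∀ f ∈ E, e ≠ f → edgeEndpoints e ≠ edgeEndpoints f

/-- An `α`-arc edge: a triple `(a,b,c)` with `a ≠ c`, `b` off of the line `ac`,
and angle `α` at `b`. -/
def IsArcEdge (α : ℝ) (e : Pt × Pt × Pt) : Prop :=
  e.1 ≠ e.2.2 ∧ e.2.1 ∉ affineSpan ℝ ({e.1, e.2.2} : Set Pt) ∧ ∠ e.1 e.2.1 e.2.2 = α

/-- The image of an arc edge `(a,b,c)`: `{a,c}` together with the points strictly on the
same side of line `ac` as `b` from which the segment `ac` subtends the same angle as at `b`. -/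
def arcImage (e : Pt × Pt × Pt) : Set Pt :=
  ({e.1, e.2.2} : Set Pt) ∪
    {x : Pt | (affineSpan ℝ ({e.1, e.2.2} : Set Pt)).SSameSide x e.2.1 ∧
      ∠ e.1 x e.2.2 = ∠ e.1 e.2.1 e.2.2}

/-- A plane `α`-arc multigraph on a finite vertex set `V`. -/
def IsPlaneArcMultigraph (α : ℝ) (V : Finset Pt) (E : Finset (Pt × Pt × Pt)) : Prop :=
  (∀ e ∈ E, IsArcEdge α e ∧ e.1 ∈ V ∧ e.2.2 ∈ V) ∧
  (∀ e ∈ E, ∀ f ∈ E, e ≠ f → arcImage e ≠ arcImage f) ∧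
  (∀ e ∈ E, ∀ v ∈ V, (v : Pt) ∈ arcImage e → (v : Pt) ∈ edgeEndpoints e) ∧
  (∀ e ∈ E, ∀ f ∈ E, e ≠ f →
    arcImage e ∩ arcImage f ⊆ edgeEndpoints e ∩ edgeEndpoints f)

/-- A plane `α`-arc graph: a plane `α`-arc multigraph in which distinct edges
have distinct endpoint pairs. -/
def IsPlaneArcGraph (α : ℝ) (V : Finset Pt) (E : Finset (Pt × Pt × Pt)) : Prop :=
  IsPlaneArcMultigraph α V E ∧
  ∀ e ∈ E, ∀ f ∈ E, e ≠ f → edgeEndpoints e ≠ edgeEndpoints f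

/-- A finite point set is in general position if no three of its points are collinear. -/
def GenPos (P : Finset Pt) : Prop :=
  ∀ p ∈ P, ∀ q ∈ P, ∀ r ∈ P, p ≠ q → p ≠ r → q ≠ r →
    ¬ Collinear ℝ ({p, q, r} : Set Pt)

/-- A planar straight-line graph on `P`: edges are (ordered representatives of unordered)
pairs of distinct points of `P` whose closed segments pairwise intersect only in shared
endpoints, and no segment contains a point of `P` other than its endpoints. -/
def IsPSLG (P : Finset Pt) (E : Finset (Pt × Pt)) : Prop :=
  (∀ e ∈ E, e.1 ∈ P ∧ e.2 ∈ P ∧ e.1 ≠ e.2) ∧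
  (∀ e ∈ E, ∀ f ∈ E, e ≠ f → segment ℝ e.1 e.2 ≠ segment ℝ f.1 f.2) ∧
  (∀ e ∈ E, ∀ p ∈ P, (p : Pt) ∈ segment ℝ e.1 e.2 → p = e.1 ∨ p = e.2) ∧
  (∀ e ∈ E, ∀ f ∈ E, e ≠ f →
    segment ℝ e.1 e.2 ∩ segment ℝ f.1 f.2 ⊆ ({e.1, e.2} : Set Pt) ∩ ({f.1, f.2} : Set Pt))

/-- `M P`: the maximum number of edges of a planar straight-line graph on `P`. -/
def M (P : Finset Pt) : ℕ :=
  sSup {m : ℕ | ∃ E : Finset (Pt × Pt), IsPSLG P E ∧ E.card = m}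

/-- Two segments (given by their endpoint pairs) cross: they meet in exactly one point,
which lies in the relative interior (open segment) of both. -/
def SegCross (s t : Pt × Pt) : Prop :=
  ∃ x : Pt, segment ℝ s.1 s.2 ∩ segment ℝ t.1 t.2 = {x} ∧
    x ∈ openSegment ℝ s.1 s.2 ∧ x ∈ openSegment ℝ t.1 t.2

set_option linter.unusedSectionVars false

/-! ### Part 1: combinatorial Euler-type inequality for straight-line drawings -/

/-- A straight-line drawing: vertices with coordinates, edges with left and right ends. -/
structure Drawing (V S : Type) where
  X : V → ℝ
  Y : V → ℝ
  l : S → V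
  r : S → V

namespace Drawing

variable {V S : Type} (D : Drawing V S)

def slope (s : S) : ℝ := (D.Y (D.r s) - D.Y (D.l s)) / (D.X (D.r s) - D.X (D.l s))

def H (s : S) (x : ℝ) : ℝ := D.Y (D.l s) + D.slope s * (x - D.X (D.l s))

structure Good : Prop where
  injX : Function.Injective D.X
  lr : ∀ s, D.X (D.l s) < D.X (D.r s)
  plan : ∀ s t, s ≠ t → ∀ x, D.X (D.l s) ≤ x → x ≤ D.X (D.r s) → D.X (D.l t) ≤ x →
    x ≤ D.X (D.r t) → D.H s x = D.H t x →
    ∃ v, (v = D.l s ∨ v = D.r s) ∧ (v = D.l t ∨ v = D.r t) ∧ D.X v = x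

variable {D}

lemma H_l (s : S) : D.H s (D.X (D.l s)) = D.Y (D.l s) := by simp [H]

lemma H_r (hD : D.Good) (s : S) : D.H s (D.X (D.r s)) = D.Y (D.r s) := by
  have := hD.lr s
  have h : D.X (D.r s) - D.X (D.l s) ≠ 0 := by linarith
  unfold H slope
  field_simp
  ring

lemma H_r' (hD : D.Good) (s : S) (x : ℝ) :
    D.H s x = D.Y (D.r s) + D.slope s * (x - D.X (D.r s)) := by
  rw [← H_r hD s]; unfold H; ring

lemma H_cont (s : S) : Continuous (D.H s) := by
  unfold H; fun_prop

lemma sign_const {d : ℝ → ℝ} (hd : Continuous d) {I : Set ℝ} (hI : I.OrdConnected)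
    (h0 : ∀ x ∈ I, d x ≠ 0) {x y : ℝ} (hx : x ∈ I) (hy : y ∈ I) (h : 0 < d x) : 0 < d y := by
  by_contra hn
  push Not at hn
  have h1 := intermediate_value_uIcc (a := x) (b := y) (f := d) hd.continuousOn
  have h2 : (0:ℝ) ∈ uIcc (d x) (d y) := by
    rw [uIcc_of_ge (by linarith)]; exact ⟨hn, h.le⟩
  obtain ⟨w, hw, hw0⟩ := h1 h2
  exact h0 w (hI.uIcc_subset hx hy hw) hw0

/-- `t` is above `s` somewhere on the common open range. -/
def Ab (D : Drawing V S) (t s : S) : Prop :=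
  ∃ x, D.X (D.l s) < x ∧ x < D.X (D.r s) ∧ D.X (D.l t) < x ∧ x < D.X (D.r t) ∧ D.H s x < D.H t x

def Over (D : Drawing V S) (t : S) (v : V) : Prop :=
  D.X (D.l t) < D.X v ∧ D.X v < D.X (D.r t) ∧ D.Y v < D.H t (D.X v)

def Reg (D : Drawing V S) (s : S) (v : V) : Prop :=
  D.X (D.l s) < D.X v ∧ D.X v < D.X (D.r s) ∧ D.H s (D.X v) < D.Y v

open Classical in
def ind (p : Prop) : ZMod 2 := if p then 1 else 0

lemma ind_true {p : Prop} (h : p) : ind p = 1 := by simp [ind, h]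
lemma ind_false {p : Prop} (h : ¬ p) : ind p = 0 := by simp [ind, h]
lemma ind_congr {p q : Prop} (h : p ↔ q) : ind p = ind q := by rw [propext h]

lemma Ab_of_pos (hD : D.Good) {s t : S} (hst : s ≠ t) {u : ℝ}
    (h1 : D.X (D.l s) ≤ u) (h2 : D.X (D.l t) ≤ u)
    (h3 : u < D.X (D.r s)) (h4 : u < D.X (D.r t))
    (hne : D.l s ≠ D.l t) :
    D.H s u < D.H t u ↔ D.Ab t s := by
  have hc : Continuous (fun x => D.H t x - D.H s x) := (H_cont t).sub (H_cont s)
  have h0 : ∀ x ∈ Ico u (min (D.X (D.r s)) (D.X (D.r t))), D.H t x - D.H s x ≠ 0 := by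
    rintro x ⟨hx1, hx2⟩ h
    have hx3 := lt_of_lt_of_le hx2 (min_le_left _ _)
    have hx4 := lt_of_lt_of_le hx2 (min_le_right _ _)
    obtain ⟨v, hv1, hv2, hv3⟩ := hD.plan s t hst x (by linarith) (by linarith) (by linarith)
      (by linarith) (by linarith)
    rcases hv1 with rfl | rfl
    · rcases hv2 with h | h
      · exact hne h
      · rw [h] at hv3; linarith
    · linarith
  have hI := @ordConnected_Ico ℝ _ u (min (D.X (D.r s)) (D.X (D.r t)))
  have hu : u < min (D.X (D.r s)) (D.X (D.r t)) := lt_min h3 h4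
  constructor
  · intro h
    obtain ⟨x, hx1, hx2⟩ := exists_between hu
    have := sign_const hc hI h0 ⟨le_rfl, hu⟩ (y := x) ⟨hx1.le, hx2⟩ (by simpa using h)
    exact ⟨x, by linarith, lt_of_lt_of_le hx2 (min_le_left _ _), by linarith,
      lt_of_lt_of_le hx2 (min_le_right _ _), by simpa using this⟩
  · rintro ⟨x, hx1, hx2, hx3, hx4, hx5⟩
    by_cases hxu : u ≤ x
    · have := sign_const hc hI h0 (x := x) (y := u) ⟨hxu, lt_min hx2 hx4⟩ ⟨le_rfl, hu⟩
        (by simpa using hx5)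
      simpa using this
    · push Not at hxu
      -- the sign is also constant on `[x,u]`
      have hI' := @ordConnected_Icc ℝ _ x u
      have h0' : ∀ y ∈ Icc x u, D.H t y - D.H s y ≠ 0 := by
        rintro y ⟨hy1, hy2⟩ h
        obtain ⟨v, hv1, hv2, hv3⟩ := hD.plan s t hst y (by linarith) (by linarith) (by linarith)
          (by linarith) (by linarith)
        rcases hv1 with rfl | rfl
        · linarith
        · linarith
      have := sign_const hc hI' h0' (x := x) (y := u) ⟨le_rfl, hxu.le⟩ ⟨hxu.le, le_rfl⟩
        (by simpa using hx5)
      simpa using this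

lemma Ab_of_pos_r (hD : D.Good) {s t : S} (hst : s ≠ t) {u : ℝ}
    (h1 : D.X (D.l s) < u) (h2 : D.X (D.l t) < u)
    (h3 : u ≤ D.X (D.r s)) (h4 : u ≤ D.X (D.r t))
    (hne : D.r s ≠ D.r t) :
    D.H s u < D.H t u ↔ D.Ab t s := by
  have hc : Continuous (fun x => D.H t x - D.H s x) := (H_cont t).sub (H_cont s)
  have h0 : ∀ x ∈ Ioc (max (D.X (D.l s)) (D.X (D.l t))) (min (D.X (D.r s)) (D.X (D.r t))),
      D.H t x - D.H s x ≠ 0 := by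
    rintro x ⟨hx1, hx2⟩ h
    have hx3 := le_trans hx2 (min_le_left _ _)
    have hx4 := le_trans hx2 (min_le_right _ _)
    have hx5 := lt_of_le_of_lt (le_max_left _ _) hx1
    have hx6 := lt_of_le_of_lt (le_max_right _ _) hx1
    obtain ⟨v, hv1, hv2, hv3⟩ := hD.plan s t hst x (by linarith) (by linarith) (by linarith)
      (by linarith) (by linarith)
    rcases hv1 with rfl | rfl
    · linarith
    · rcases hv2 with h | h
      · rw [h] at hv3; linarith
      · exact hne h
  have hI : (Ioc (max (D.X (D.l s)) (D.X (D.l t)))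
    (min (D.X (D.r s)) (D.X (D.r t)))).OrdConnected := ordConnected_Ioc
  have hu : u ∈ Ioc (max (D.X (D.l s)) (D.X (D.l t))) (min (D.X (D.r s)) (D.X (D.r t))) :=
    ⟨max_lt h1 h2, le_min h3 h4⟩
  constructor
  · intro h
    obtain ⟨x, hx1, hx2⟩ := exists_between hu.1
    have := sign_const hc hI h0 hu (y := x) ⟨hx1, hx2.le.trans hu.2⟩ (by simpa using h)
    exact ⟨x, lt_of_le_of_lt (le_max_left _ _) hx1, by linarith,
      lt_of_le_of_lt (le_max_right _ _) hx1, by linarith, by simpa using this⟩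
  · rintro ⟨x, hx1, hx2, hx3, hx4, hx5⟩
    have := sign_const hc hI h0 (x := x) (y := u) ⟨max_lt hx1 hx3, le_min hx2.le hx4.le⟩ hu
        (by simpa using hx5)
    simpa using this

lemma left_count (hD : D.Good) (s t : S) :
    ind (D.Over t (D.l s)) + ind (D.l t = D.l s ∧ D.slope s < D.slope t) + ind (D.Reg s (D.l t))
      = ind (D.Ab t s) := by
  by_cases hst : s = t
  · subst hst
    rw [ind_false, ind_false, ind_false, ind_false]
    · simp
    · rintro ⟨x, h⟩; linarith [h.2.2.2.2]
    · rintro ⟨h, -⟩; linarith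
    · rintro ⟨-, h⟩; linarith
    · rintro ⟨h, -⟩; linarith
  rcases lt_trichotomy (D.X (D.l t)) (D.X (D.l s)) with h | h | h
  · have h2 : ¬ (D.l t = D.l s ∧ D.slope s < D.slope t) := by
      rintro ⟨h', -⟩; rw [h'] at h; linarith
    have h3 : ¬ D.Reg s (D.l t) := by rintro ⟨h', -⟩; linarith
    rw [ind_false h2, ind_false h3, add_zero, add_zero]
    apply ind_congr
    by_cases h4 : D.X (D.l s) < D.X (D.r t)
    · rw [← Ab_of_pos hD hst le_rfl h.le (hD.lr s) h4 (by rintro h'; rw [h'] at h; linarith), H_l]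
      exact ⟨fun h => h.2.2, fun h' => ⟨h, h4, h'⟩⟩
    · constructor
      · rintro ⟨-, h', -⟩; exact absurd h' h4
      · rintro ⟨x, h5, h6, h7, h8, -⟩; linarith
  · have hv := hD.injX h
    have h2 : ¬ D.Over t (D.l s) := by rintro ⟨h', -⟩; linarith
    have h3 : ¬ D.Reg s (D.l t) := by rintro ⟨h', -⟩; linarith
    rw [ind_false h2, ind_false h3, add_zero, zero_add]
    apply ind_congr
    have h5 : ∀ x, D.H t x - D.H s x = (D.slope t - D.slope s) * (x - D.X (D.l s)) := by
      intro x; unfold H; rw [hv]; ring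
    constructor
    · rintro ⟨-, h6⟩
      obtain ⟨x, hx1, hx2⟩ := exists_between (lt_min (hD.lr s) (h ▸ hD.lr t))
      have h7 := h5 x
      have : 0 < (D.slope t - D.slope s) * (x - D.X (D.l s)) := by
        apply mul_pos <;> linarith
      exact ⟨x, hx1, lt_of_lt_of_le hx2 (min_le_left _ _), by linarith,
        lt_of_lt_of_le hx2 (min_le_right _ _), by linarith⟩
    · rintro ⟨x, hx1, hx2, hx3, hx4, hx5⟩
      refine ⟨hv, ?_⟩
      have h7 := h5 x
      by_contra hn
      push Not at hn
      have : (D.slope t - D.slope s) * (x - D.X (D.l s)) ≤ 0 :=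
        mul_nonpos_of_nonpos_of_nonneg (by linarith) (by linarith)
      linarith
  · have h2 : ¬ (D.l t = D.l s ∧ D.slope s < D.slope t) := by
      rintro ⟨h', -⟩; rw [h'] at h; linarith
    have h3 : ¬ D.Over t (D.l s) := by rintro ⟨h', -⟩; linarith
    rw [ind_false h2, ind_false h3, add_zero, zero_add]
    apply ind_congr
    by_cases h4 : D.X (D.l t) < D.X (D.r s)
    · rw [← Ab_of_pos hD hst h.le le_rfl h4 (hD.lr t) (by rintro h'; rw [h'] at h; linarith), H_l]
      exact ⟨fun h => h.2.2, fun h' => ⟨h, h4, h'⟩⟩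
    · constructor
      · rintro ⟨-, h', -⟩; exact absurd h' h4
      · rintro ⟨x, h5, h6, h7, h8, -⟩; linarith

lemma right_count (hD : D.Good) (s t : S) :
    ind (D.Over t (D.r s)) + ind (D.r t = D.r s ∧ D.slope t < D.slope s) + ind (D.Reg s (D.r t))
      = ind (D.Ab t s) := by
  by_cases hst : s = t
  · subst hst
    rw [ind_false, ind_false, ind_false, ind_false]
    · simp
    · rintro ⟨x, h⟩; linarith [h.2.2.2.2]
    · rintro ⟨-, h, -⟩; linarith
    · rintro ⟨-, h⟩; linarith
    · rintro ⟨-, h, -⟩; linarith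
  rcases lt_trichotomy (D.X (D.r s)) (D.X (D.r t)) with h | h | h
  · have h2 : ¬ (D.r t = D.r s ∧ D.slope t < D.slope s) := by
      rintro ⟨h', -⟩; rw [h'] at h; linarith
    have h3 : ¬ D.Reg s (D.r t) := by rintro ⟨-, h', -⟩; linarith
    rw [ind_false h2, ind_false h3, add_zero, add_zero]
    apply ind_congr
    by_cases h4 : D.X (D.l t) < D.X (D.r s)
    · rw [← Ab_of_pos_r hD hst (hD.lr s) h4 le_rfl h.le (by rintro h'; rw [h'] at h; linarith),
        H_r hD]
      exact ⟨fun h => h.2.2, fun h' => ⟨h4, h, h'⟩⟩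
    · constructor
      · rintro ⟨h', -⟩; exact absurd h' h4
      · rintro ⟨x, h5, h6, h7, h8, -⟩; linarith
  · have hv := hD.injX h
    have h2 : ¬ D.Over t (D.r s) := by rintro ⟨-, h', -⟩; linarith
    have h3 : ¬ D.Reg s (D.r t) := by rintro ⟨-, h', -⟩; linarith
    rw [ind_false h2, ind_false h3, add_zero, zero_add]
    apply ind_congr
    have h5 : ∀ x, D.H t x - D.H s x = (D.slope s - D.slope t) * (D.X (D.r s) - x) := by
      intro x; rw [H_r' hD, H_r' hD s, hv]; ring
    constructor
    · rintro ⟨-, h6⟩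
      obtain ⟨x, hx1, hx2⟩ := exists_between (max_lt (hD.lr s) (h ▸ hD.lr t))
      have h7 := h5 x
      have : 0 < (D.slope s - D.slope t) * (D.X (D.r s) - x) := by
        apply mul_pos <;> linarith
      exact ⟨x, lt_of_le_of_lt (le_max_left _ _) hx1, hx2, 
        lt_of_le_of_lt (le_max_right _ _) hx1, by linarith, by linarith⟩
    · rintro ⟨x, hx1, hx2, hx3, hx4, hx5⟩
      refine ⟨hv.symm, ?_⟩
      have h7 := h5 x
      by_contra hn
      push Not at hn
      have : (D.slope s - D.slope t) * (D.X (D.r s) - x) ≤ 0 :=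
        mul_nonpos_of_nonpos_of_nonneg (by linarith) (by linarith)
      linarith
  · have h2 : ¬ (D.r t = D.r s ∧ D.slope t < D.slope s) := by
      rintro ⟨h', -⟩; rw [h'] at h; linarith
    have h3 : ¬ D.Over t (D.r s) := by rintro ⟨-, h', -⟩; linarith
    rw [ind_false h2, ind_false h3, add_zero, zero_add]
    apply ind_congr
    by_cases h4 : D.X (D.l s) < D.X (D.r t)
    · rw [← Ab_of_pos_r hD hst h4 (hD.lr t) h.le le_rfl (by rintro h'; rw [h'] at h; linarith),
        H_r hD]
      exact ⟨fun h => h.2.2, fun h' => ⟨h4, h, h'⟩⟩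
    · constructor
      · rintro ⟨h', -⟩; exact absurd h' h4
      · rintro ⟨x, h5, h6, h7, h8, -⟩; linarith

/-! #### The cycle space and the side labels -/

variable [Fintype V] [Fintype S]

variable (D) in
/-- The boundary map over `ZMod 2`. -/
def bd : (S → ZMod 2) →ₗ[ZMod 2] (V → ZMod 2) where
  toFun z v := ∑ s, ind (D.l s = v) * z s + ∑ s, ind (D.r s = v) * z s
  map_add' z w := by
    funext v; simp only [Pi.add_apply, mul_add, Finset.sum_add_distrib]; ring
  map_smul' c z := by
    funext v
    simp only [Pi.smul_apply, smul_eq_mul, RingHom.id_apply, mul_add, Finset.mul_sum]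
    congr 1 <;> exact Finset.sum_congr rfl (fun s _ => by ring)

variable (D) in
/-- The cycle space. -/
abbrev Z : Submodule (ZMod 2) (S → ZMod 2) := LinearMap.ker D.bd

lemma Z_eq (z : D.Z) (v : V) :
    ∑ s, ind (D.l s = v) * z.1 s = ∑ s, ind (D.r s = v) * z.1 s := by
  have h := congrFun (LinearMap.mem_ker.1 z.2) v
  change ∑ s, ind (D.l s = v) * z.1 s + ∑ s, ind (D.r s = v) * z.1 s = 0 at h
  exact CharTwo.add_eq_zero.1 h

variable (D) in
def A (v : V) : D.Z → ZMod 2 := fun z => ∑ t, ind (D.Over t v) * z.1 t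

variable (D) in
def ev (s : S) : D.Z → ZMod 2 := fun z => z.1 s

open Classical in
variable (D) in
def Wp (s : S) : D.Z → ZMod 2 :=
  D.A (D.l s) + ∑ t ∈ Finset.univ.filter (fun t => D.l t = D.l s ∧ D.slope s < D.slope t), D.ev t

variable (D) in
def Wm (s : S) : D.Z → ZMod 2 := D.Wp s + D.ev s

lemma sum_filter_ind {ι : Type} [Fintype ι] (p : ι → Prop) [DecidablePred p] (g : ι → ZMod 2) :
    ∑ t ∈ Finset.univ.filter p, g t = ∑ t, ind (p t) * g t := by
  rw [Finset.sum_filter]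
  refine Finset.sum_congr rfl (fun t _ => ?_)
  by_cases h : p t
  · rw [ind_true h]; simp [h]
  · rw [ind_false h]; simp [h]

lemma Wp_apply (s : S) (z : D.Z) :
    D.Wp s z = ∑ t, (ind (D.Over t (D.l s)) + ind (D.l t = D.l s ∧ D.slope s < D.slope t)) * z.1 t := by
  classical
  simp only [Wp, A, ev, Pi.add_apply, Finset.sum_apply, add_mul, Finset.sum_add_distrib]
  congr 1
  exact sum_filter_ind _ _

lemma ind_and {p q : Prop} : ind (p ∧ q) = ind p * ind q := by
  unfold ind; by_cases p <;> by_cases q <;> simp_all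

/-- Key lemma: the label of the upper side computed at the right end. -/
lemma Wp_eq_right (hD : D.Good) (s : S) (z : D.Z) :
    D.Wp s z = ∑ t, (ind (D.Over t (D.r s)) + ind (D.r t = D.r s ∧ D.slope t < D.slope s)) * z.1 t := by
  have h1 : ∑ t, ind (D.Reg s (D.l t)) * z.1 t = ∑ t, ind (D.Reg s (D.r t)) * z.1 t := by
    have key : ∀ g : S → V, ∑ t, ind (D.Reg s (g t)) * z.1 t
        = ∑ v, ind (D.Reg s v) * ∑ t, ind (g t = v) * z.1 t := by
      intro g
      simp only [Finset.mul_sum]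
      rw [Finset.sum_comm]
      refine Finset.sum_congr rfl (fun t _ => ?_)
      rw [Finset.sum_eq_single (g t)]
      · rw [ind_true rfl]; ring
      · intro v _ hv; rw [ind_false (p := g t = v) (fun h => hv h.symm)]; ring
      · simp
    rw [key, key]
    exact Finset.sum_congr rfl (fun v _ => by rw [Z_eq])
  rw [Wp_apply]
  have h2 : ∑ t, (ind (D.Over t (D.l s)) + ind (D.l t = D.l s ∧ D.slope s < D.slope t)) * z.1 t
      + ∑ t, ind (D.Reg s (D.l t)) * z.1 t =
      ∑ t, (ind (D.Over t (D.r s)) + ind (D.r t = D.r s ∧ D.slope t < D.slope s)) * z.1 t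
      + ∑ t, ind (D.Reg s (D.r t)) * z.1 t := by
    rw [← Finset.sum_add_distrib, ← Finset.sum_add_distrib]
    refine Finset.sum_congr rfl (fun t _ => ?_)
    rw [← add_mul, ← add_mul, left_count hD, right_count hD]
  rw [h1] at h2
  exact add_right_cancel h2

open Classical in
lemma Wp_right (hD : D.Good) (s : S) : D.Wp s = D.A (D.r s) +
    ∑ t ∈ Finset.univ.filter (fun t => D.r t = D.r s ∧ D.slope t < D.slope s), D.ev t := by
  funext z
  rw [Wp_eq_right hD]
  simp only [A, ev, Pi.add_apply, Finset.sum_apply, add_mul, Finset.sum_add_distrib]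
  congr 1
  exact (sum_filter_ind _ _).symm

open Classical in
/-- Telescoping around a vertex. -/
lemma tele {ι B : Type} [AddCommGroup B] (R : Finset ι) (κ : ι → ℝ) (hκ : Set.InjOn κ R)
    (a : B) (ev : ι → B) (f : B) :
    ∑ r ∈ R, (ind (a + ∑ s ∈ R.filter (fun s => κ r < κ s), ev s = f) +
      ind (a + ∑ s ∈ R.filter (fun s => κ r < κ s), ev s + ev r = f))
      = ind (a = f) + ind (a + ∑ s ∈ R, ev s = f) := by
  revert hκ
  induction R using Finset.induction_on_min_value κ with
  | empty => intro _; simp [CharTwo.add_self_eq_zero]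
  | insert x R hx hmin ih =>
    intro hκ
    have hκ' : Set.InjOn κ R := hκ.mono (by simp)
    rw [Finset.sum_insert hx]
    have e1 : (insert x R).filter (fun s => κ x < κ s) = R := by
      ext s
      simp only [Finset.mem_filter, Finset.mem_insert]
      constructor
      · rintro ⟨rfl | h, h'⟩
        · exact absurd h' (lt_irrefl _)
        · exact h
      · intro h
        refine ⟨Or.inr h, lt_of_le_of_ne (hmin s h) ?_⟩
        intro h'
        have := hκ (by simp) (by simp [h]) h'
        exact hx (this ▸ h)
    have e2 : ∀ r ∈ R, (insert x R).filter (fun s => κ r < κ s) = R.filter (fun s => κ r < κ s) := by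
      intro r hr
      rw [Finset.filter_insert, if_neg (not_lt.2 (hmin r hr))]
    have e3 : ∑ r ∈ R, (ind (a + ∑ s ∈ (insert x R).filter (fun s => κ r < κ s), ev s = f) +
        ind (a + ∑ s ∈ (insert x R).filter (fun s => κ r < κ s), ev s + ev r = f)) =
        ∑ r ∈ R, (ind (a + ∑ s ∈ R.filter (fun s => κ r < κ s), ev s = f) +
        ind (a + ∑ s ∈ R.filter (fun s => κ r < κ s), ev s + ev r = f)) :=
      Finset.sum_congr rfl (fun r hr => by rw [e2 r hr])
    rw [e1, e3, ih hκ', Finset.sum_insert hx,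
      add_comm (ev x), add_assoc a]
    have := CharTwo.add_self_eq_zero (ind (a + ∑ s ∈ R, ev s = f))
    linear_combination this

variable (D) in
/-- The boundary of the face with label `f`. -/
def zf (f : D.Z → ZMod 2) (s : S) : ZMod 2 := ind (D.Wp s = f) + ind (D.Wm s = f)

lemma slope_injOn_l (hD : D.Good) (v : V) : Set.InjOn D.slope {s | D.l s = v} := by
  intro s hs t ht h
  by_contra hne
  simp only [mem_ofPred_eq] at hs ht
  obtain ⟨x, hx1, hx2⟩ := exists_between (lt_min (hD.lr s) (show D.X (D.l s) < D.X (D.r t) by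
    rw [hs, ← ht]; exact hD.lr t))
  have h3 := lt_of_lt_of_le hx2 (min_le_left _ _)
  have h4 := lt_of_lt_of_le hx2 (min_le_right _ _)
  obtain ⟨w, hw1, hw2, hw3⟩ := hD.plan s t hne x hx1.le h3.le (by rw [ht, ← hs]; exact hx1.le) h4.le
    (by unfold H; rw [hs, ht, h])
  rcases hw1 with rfl | rfl <;> linarith

lemma slope_injOn_r (hD : D.Good) (v : V) : Set.InjOn D.slope {s | D.r s = v} := by
  intro s hs t ht h
  by_contra hne
  simp only [mem_ofPred_eq] at hs ht
  obtain ⟨x, hx1, hx2⟩ := exists_between (max_lt (hD.lr s) (show D.X (D.l t) < D.X (D.r s) by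
    rw [hs, ← ht]; exact hD.lr t))
  have h3 := lt_of_le_of_lt (le_max_left _ _) hx1
  have h4 := lt_of_le_of_lt (le_max_right _ _) hx1
  obtain ⟨w, hw1, hw2, hw3⟩ := hD.plan s t hne x h3.le hx2.le h4.le (by rw [ht, ← hs]; exact hx2.le)
    (by rw [H_r' hD, H_r' hD t, hs, ht, h])
  rcases hw1 with rfl | rfl <;> linarith

open Classical in
lemma partial_l (hD : D.Good) (f : D.Z → ZMod 2) (g : S) :
    ∑ s ∈ Finset.univ.filter (fun t => D.l t = D.l g ∧ D.slope g < D.slope t), D.zf f s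
      = ind (D.A (D.l g) = f) + ind (D.Wp g = f) := by
  have h := tele (Finset.univ.filter (fun t => D.l t = D.l g ∧ D.slope g < D.slope t)) D.slope
    ((slope_injOn_l hD (D.l g)).mono (by intro s; simp; tauto)) (D.A (D.l g)) D.ev f
  have hW : D.Wp g = D.A (D.l g) + ∑ t ∈ Finset.univ.filter
      (fun t => D.l t = D.l g ∧ D.slope g < D.slope t), D.ev t := rfl
  rw [← hW] at h
  rw [← h]
  refine Finset.sum_congr rfl (fun s hs => ?_)
  simp only [Finset.mem_filter, Finset.mem_univ, true_and] at hs
  unfold zf Wm Wp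
  rw [Finset.filter_filter, hs.1]
  have : (fun t => D.l t = D.l g ∧ D.slope s < D.slope t) =
      (fun t => (D.l t = D.l g ∧ D.slope g < D.slope t) ∧ D.slope s < D.slope t) := by
    funext t
    apply propext
    constructor
    · rintro ⟨h1, h2⟩; exact ⟨⟨h1, hs.2.trans h2⟩, h2⟩
    · rintro ⟨⟨h1, h2⟩, h3⟩; exact ⟨h1, h3⟩
  simp only [this]

open Classical in
lemma partial_r (hD : D.Good) (f : D.Z → ZMod 2) (g : S) :
    ∑ s ∈ Finset.univ.filter (fun t => D.r t = D.r g ∧ D.slope t < D.slope g), D.zf f s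
      = ind (D.A (D.r g) = f) + ind (D.Wp g = f) := by
  have h := tele (Finset.univ.filter (fun t => D.r t = D.r g ∧ D.slope t < D.slope g))
    (fun s => - D.slope s)
    (neg_injective.comp_injOn ((slope_injOn_r hD (D.r g)).mono (by intro s; simp; tauto)))
    (D.A (D.r g)) D.ev f
  rw [← Wp_right hD] at h
  rw [← h]
  refine Finset.sum_congr rfl (fun s hs => ?_)
  simp only [Finset.mem_filter, Finset.mem_univ, true_and] at hs
  unfold zf Wm
  rw [Wp_right hD s, Finset.filter_filter, hs.1]
  have : (fun t => D.r t = D.r g ∧ D.slope t < D.slope s) =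
      (fun t => (D.r t = D.r g ∧ D.slope t < D.slope g) ∧ - D.slope s < - D.slope t) := by
    funext t
    apply propext
    constructor
    · rintro ⟨h1, h2⟩; exact ⟨⟨h1, h2.trans hs.2⟩, neg_lt_neg h2⟩
    · rintro ⟨⟨h1, h2⟩, h3⟩; exact ⟨h1, by linarith⟩
  simp only [this]

/-- Face boundaries are cycles. -/
lemma zf_mem (hD : D.Good) (f : D.Z → ZMod 2) : D.zf f ∈ D.Z := by
  classical
  rw [LinearMap.mem_ker]
  funext v
  change ∑ s, ind (D.l s = v) * D.zf f s + ∑ s, ind (D.r s = v) * D.zf f s = 0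
  have hl := tele (Finset.univ.filter (fun t => D.l t = v)) D.slope
    ((slope_injOn_l hD v).mono (by intro s; simp)) (D.A v) D.ev f
  have hr := tele (Finset.univ.filter (fun t => D.r t = v)) (fun s => - D.slope s)
    (neg_injective.comp_injOn ((slope_injOn_r hD v).mono (by intro s; simp))) (D.A v) D.ev f
  rw [CharTwo.add_eq_zero, ← sum_filter_ind (fun s => D.l s = v), ← sum_filter_ind (fun s => D.r s = v)]
  have e : ∑ s ∈ Finset.univ.filter (fun t => D.l t = v), D.ev s =
      ∑ s ∈ Finset.univ.filter (fun t => D.r t = v), D.ev s := by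
    funext z
    simp only [Finset.sum_apply, ev]
    rw [sum_filter_ind, sum_filter_ind, Z_eq]
  rw [e, ← hr] at hl
  convert hl using 1
  · refine Finset.sum_congr rfl (fun s hs => ?_)
    simp only [Finset.mem_filter, Finset.mem_univ, true_and] at hs
    unfold zf Wm Wp
    rw [Finset.filter_filter, hs]
  · refine Finset.sum_congr rfl (fun s hs => ?_)
    simp only [Finset.mem_filter, Finset.mem_univ, true_and] at hs
    unfold zf Wm
    rw [Wp_right hD, Finset.filter_filter, hs]
    simp only [neg_lt_neg_iff]


open Classical in
variable (D) in
/-- The set of face labels with non-trivial boundary. -/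
def F : Finset (D.Z → ZMod 2) :=
  (Finset.univ.image D.Wp ∪ Finset.univ.image D.Wm).filter (fun f => D.zf f ≠ 0)

lemma zf_ne {f : D.Z → ZMod 2} {s : S} (h : D.zf f s ≠ 0) : D.Wp s = f ∨ D.Wm s = f := by
  by_contra hn
  push Not at hn
  exact h (by rw [zf, ind_false hn.1, ind_false hn.2, add_zero])

lemma mem_F {f : D.Z → ZMod 2} : f ∈ D.F ↔ D.zf f ≠ 0 := by
  classical
  unfold F
  rw [Finset.mem_filter]
  refine ⟨fun h => h.2, fun h => ⟨?_, h⟩⟩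
  obtain ⟨s, hs⟩ := Function.ne_iff.1 h
  rcases zf_ne hs with h | h
  · exact Finset.mem_union_left _ (Finset.mem_image.2 ⟨s, Finset.mem_univ _, h⟩)
  · exact Finset.mem_union_right _ (Finset.mem_image.2 ⟨s, Finset.mem_univ _, h⟩)

lemma Wp_ne_Wm {z : D.Z} {s : S} (h : z.1 s ≠ 0) : D.Wp s ≠ D.Wm s := by
  intro h'
  have := congrFun h' z
  simp only [Wm, Pi.add_apply, ev] at this
  exact h (by linear_combination -this)

lemma Wp_mem_F {z : D.Z} {s : S} (h : z.1 s ≠ 0) : D.Wp s ∈ D.F := by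
  rw [mem_F]
  apply Function.ne_iff.2
  refine ⟨s, ?_⟩
  rw [zf, ind_true rfl, ind_false (Wp_ne_Wm h).symm]
  simp

lemma Wm_mem_F {z : D.Z} {s : S} (h : z.1 s ≠ 0) : D.Wm s ∈ D.F := by
  rw [mem_F]
  apply Function.ne_iff.2
  refine ⟨s, ?_⟩
  rw [zf, ind_true rfl, ind_false (Wp_ne_Wm h)]
  simp

lemma zero_mem_F (hZ : D.Z ≠ ⊥) : (0 : D.Z → ZMod 2) ∈ D.F := by
  classical
  obtain ⟨z0, hz0, hne⟩ := Submodule.exists_mem_ne_zero_of_ne_bot hZ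
  obtain ⟨s0, hs0⟩ := Function.ne_iff.1 hne
  -- the non-bridge edges
  let N : Finset S := Finset.univ.filter (fun s => ∃ z : D.Z, z.1 s ≠ 0)
  have hN : N.Nonempty := ⟨s0, Finset.mem_filter.2 ⟨Finset.mem_univ _, ⟨z0, hz0⟩, hs0⟩⟩
  obtain ⟨s1, hs1, hmin⟩ := N.exists_min_image (fun s => D.X (D.l s)) hN
  let N' := N.filter (fun s => D.l s = D.l s1)
  obtain ⟨s, hs, hmax⟩ := N'.exists_max_image D.slope ⟨s1, by simp [N', hs1]⟩
  simp only [N', Finset.mem_filter] at hs hmax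
  have hz : D.Wp s = 0 := by
    funext z
    rw [Wp_apply]
    apply Finset.sum_eq_zero
    intro t _
    by_cases ht : z.1 t = 0
    · rw [ht, mul_zero]
    have htN : t ∈ N := Finset.mem_filter.2 ⟨Finset.mem_univ _, z, ht⟩
    rw [ind_false, ind_false]
    · simp
    · rintro ⟨h1, h2⟩
      have := hmax t ⟨htN, h1.trans hs.2⟩
      linarith
    · rintro ⟨h1, -⟩
      have := hmin t htN
      rw [hs.2] at h1
      linarith
  obtain ⟨z, hzs⟩ := (Finset.mem_filter.1 hs.1).2
  rw [← hz]
  exact Wp_mem_F hzs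

lemma finrank_le (hZ : D.Z ≠ ⊥) :
    Module.finrank (ZMod 2) D.Z + 1 ≤ D.F.card := by
  classical
  let F' := D.F.erase 0
  have hF' : F'.card + 1 = D.F.card := Finset.card_erase_add_one (zero_mem_F hZ)
  rw [← hF', add_le_add_iff_right]
  let Φ : D.Z → (F' → ZMod 2) := fun z f => f.1 z
  have hinj : Function.Injective Φ := by
    have hW : ∀ s (z w : D.Z), D.Wp s (z + w) = D.Wp s z + D.Wp s w := by
      intro s z w
      rw [Wp_apply, Wp_apply, Wp_apply, ← Finset.sum_add_distrib]
      exact Finset.sum_congr rfl (fun t _ => by simp [mul_add])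
    intro z w h
    ext s
    by_contra hs
    have hs' : (z + w).1 s ≠ 0 := by
      simp only [Submodule.coe_add, Pi.add_apply]
      intro h'
      exact hs (CharTwo.add_eq_zero.1 h')
    have h1 : ∀ f ∈ D.F, f z = f w := by
      intro f hf
      by_cases hf0 : f = 0
      · rw [hf0]; rfl
      · exact congrFun h ⟨f, Finset.mem_erase.2 ⟨hf0, hf⟩⟩
    have h2 := h1 _ (Wp_mem_F hs')
    have h3 := h1 _ (Wm_mem_F hs')
    simp only [Wm, Pi.add_apply, ev, h2] at h3
    exact hs (add_left_cancel h3)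
  have hc := Nat.card_le_card_of_injective Φ hinj
  rw [Nat.card_fun, Module.natCard_eq_pow_finrank (K := ZMod 2)] at hc
  simp only [Nat.card_eq_fintype_card, Fintype.card_coe, ZMod.card] at hc
  exact (Nat.pow_le_pow_iff_right (by norm_num)).1 hc

variable (D) in
lemma dim_le [Nonempty V] :
    Fintype.card S + 1 ≤ Fintype.card V + Module.finrank (ZMod 2) D.Z := by
  classical
  have h1 := LinearMap.finrank_range_add_finrank_ker D.bd
  let σ : (V → ZMod 2) →ₗ[ZMod 2] ZMod 2 := ∑ v, LinearMap.proj v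
  have hσ : ∀ x, σ x = ∑ v, x v := by intro x; simp [σ]
  have h2 := LinearMap.finrank_range_add_finrank_ker σ
  have h3 : LinearMap.range σ = ⊤ := by
    rw [LinearMap.range_eq_top]
    intro c
    obtain ⟨v⟩ := ‹Nonempty V›
    exact ⟨Pi.single v c, by rw [hσ]; simp⟩
  have h4 : LinearMap.range D.bd ≤ LinearMap.ker σ := by
    rintro _ ⟨z, rfl⟩
    rw [LinearMap.mem_ker, hσ]
    change ∑ v, (∑ s, ind (D.l s = v) * z s + ∑ s, ind (D.r s = v) * z s) = 0
    rw [Finset.sum_add_distrib]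
    have key : ∀ g : S → V, ∑ v, ∑ s, ind (g s = v) * z s = ∑ s, z s := by
      intro g
      rw [Finset.sum_comm]
      refine Finset.sum_congr rfl (fun t _ => ?_)
      rw [Finset.sum_eq_single (g t)]
      · rw [ind_true rfl]; ring
      · intro v _ hv; rw [ind_false (p := g t = v) (fun h => hv h.symm)]; ring
      · simp
    rw [key, key, CharTwo.add_self_eq_zero]
  have h5 := Submodule.finrank_mono h4
  rw [h3] at h2
  simp only [finrank_top, Module.finrank_self, Module.finrank_fintype_fun_eq_card] at h1 h2
  change _ + Module.finrank (ZMod 2) D.Z = _ at h1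
  omega

open Classical in
lemma sum_supp_le : ∑ f ∈ D.F, (Finset.univ.filter (fun s => D.zf f s ≠ 0)).card
    ≤ 2 * Fintype.card S := by
  simp only [Finset.card_filter]
  rw [Finset.sum_comm]
  have : ∀ s ∈ (Finset.univ : Finset S), ∑ f ∈ D.F, (if D.zf f s ≠ 0 then 1 else 0) ≤ 2 := by
    intro s _
    rw [← Finset.card_filter]
    calc _ ≤ ({D.Wp s, D.Wm s} : Finset (D.Z → ZMod 2)).card := by
          apply Finset.card_le_card
          intro f hf
          have := zf_ne (Finset.mem_filter.1 hf).2
          simp only [Finset.mem_insert, Finset.mem_singleton]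
          rcases this with h | h
          · exact Or.inl h.symm
          · exact Or.inr h.symm
      _ ≤ 2 := Finset.card_le_two
  refine (Finset.sum_le_sum this).trans ?_
  simp [mul_comm]

end Drawing


/-! ### Part 2: geometry of a single bend edge -/

def cr (u v : Pt) : ℝ := u 0 * v 1 - u 1 * v 0

lemma bend_facts {α : ℝ} (h0 : 0 < α) (h1 : α < π / 2) {a b c : Pt} (h : ∠ a b c = α) :
    ((b - a) 0 * (b - c) 0 + (b - a) 1 * (b - c) 1) * Real.sin α
      = |cr (b - a) (b - c)| * Real.cos α ∧ cr (b - a) (b - c) ≠ 0 := by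
  have hs : 0 < Real.sin α := Real.sin_pos_of_pos_of_lt_pi h0 (by linarith [Real.pi_pos])
  have hc : 0 < Real.cos α := Real.cos_pos_of_mem_Ioo ⟨by linarith, h1⟩
  have hang : InnerProductGeometry.angle (b - a) (b - c) = α := by
    rw [← h, EuclideanGeometry.angle, vsub_eq_sub, vsub_eq_sub, ← neg_sub a b, ← neg_sub c b,
      InnerProductGeometry.angle_neg_neg]
  set u := b - a
  set v := b - c
  have hu : u ≠ 0 := by
    intro hu; rw [hu, InnerProductGeometry.angle_zero_left] at hang; linarith
  have hv : v ≠ 0 := by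
    intro hv; rw [hv, InnerProductGeometry.angle_zero_right] at hang; linarith
  have e1 := InnerProductGeometry.cos_angle_mul_norm_mul_norm u v
  have e2 := InnerProductGeometry.sin_angle_mul_norm_mul_norm u v
  rw [hang] at e1 e2
  have i1 : ∀ u v : Pt, inner ℝ u v = u 0 * v 0 + u 1 * v 1 := by
    intro u v; simp [PiLp.inner_apply, Fin.sum_univ_two]; ring
  rw [i1] at e1
  have e3 : Real.sin α * (‖u‖ * ‖v‖) = |cr u v| := by
    rw [e2, i1, i1, i1, ← Real.sqrt_sq_eq_abs]
    congr 1
    unfold cr; ring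
  have hpos : 0 < ‖u‖ * ‖v‖ := mul_pos (norm_pos_iff.2 hu) (norm_pos_iff.2 hv)
  refine ⟨by rw [← e1, ← e3]; ring, ?_⟩
  intro hcr
  rw [hcr, abs_zero] at e3
  have := mul_pos hs hpos
  linarith

lemma seg_param {a b w : Pt} (h : w ∈ segment ℝ a b) :
    ∃ τ : ℝ, 0 ≤ τ ∧ τ ≤ 1 ∧ ∀ i, w i = b i - τ * (b - a) i := by
  obtain ⟨x, y, hx, hy, hxy, rfl⟩ := h
  refine ⟨x, hx, by linarith, fun i => ?_⟩
  simp only [PiLp.add_apply, PiLp.smul_apply, PiLp.sub_apply, smul_eq_mul]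
  have : y = 1 - x := by linarith
  rw [this]; ring

lemma pt_ext {p q : Pt} (h0 : p 0 = q 0) (h1 : p 1 = q 1) : p = q := by
  ext i; fin_cases i
  · exact h0
  · exact h1

/-- The two legs meet only at the bend. -/
lemma legs_inter {a b c w : Pt} (h : cr (b - a) (b - c) ≠ 0) (h1 : w ∈ segment ℝ a b)
    (h2 : w ∈ segment ℝ c b) : w = b := by
  obtain ⟨x, -, -, hx⟩ := seg_param h1
  obtain ⟨y, -, -, hy⟩ := seg_param h2
  have e0 : x * (b - a) 0 = y * (b - c) 0 := by linarith [hx 0, hy 0]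
  have e1 : x * (b - a) 1 = y * (b - c) 1 := by linarith [hx 1, hy 1]
  have : x * cr (b - a) (b - c) = 0 := by
    unfold cr; linear_combination (b - c) 1 * e0 - (b - c) 0 * e1
  have hx0 : x = 0 := by
    rcases mul_eq_zero.1 this with h' | h'
    · exact h'
    · exact absurd h' h
  apply pt_ext
  · rw [hx 0, hx0]; ring
  · rw [hx 1, hx0]; ring

lemma end_not_mem {a b c : Pt} (h : cr (b - a) (b - c) ≠ 0) : c ∉ segment ℝ a b := by
  intro h1
  obtain ⟨x, -, -, hx⟩ := seg_param h1
  apply h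
  unfold cr
  have e0 : (b - c) 0 = x * (b - a) 0 := by
    rw [PiLp.sub_apply, hx 0]; ring
  have e1 : (b - c) 1 = x * (b - a) 1 := by
    rw [PiLp.sub_apply, hx 1]; ring
  rw [e0, e1]; ring

/-- Strictly nested cones have different angles (scalar form). -/
lemma nested_angle {k t p0 p1 q0 q1 r0 r1 s0 s1 : ℝ}
    (hp : 0 < p0 + t * p1) (hq : 0 < q0 + t * q1) (hr : 0 < r0 + t * r1) (hs : 0 < s0 + t * s1)
    (h1 : 0 ≤ p0 * q1 - p1 * q0) (h2 : 0 < q0 * r1 - q1 * r0) (h3 : 0 ≤ r0 * s1 - r1 * s0)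
    (h13 : 0 < p0 * q1 - p1 * q0 ∨ 0 < r0 * s1 - r1 * s0)
    (e1 : p0 * s0 + p1 * s1 = k * (p0 * s1 - p1 * s0))
    (e2 : q0 * r0 + q1 * r1 = k * (q0 * r1 - q1 * r0)) : False := by
  -- cross (p, r) > 0 and cross (p, s) > 0
  have c1 : 0 < p0 * r1 - p1 * r0 := by
    have : (q0 + t * q1) * (p0 * r1 - p1 * r0) = (p0 + t * p1) * (q0 * r1 - q1 * r0)
      + (r0 + t * r1) * (p0 * q1 - p1 * q0) := by ring
    have h : 0 < (q0 + t * q1) * (p0 * r1 - p1 * r0) := by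
      rw [this]; have := mul_pos hp h2; have := mul_nonneg hr.le h1; linarith
    exact pos_of_mul_pos_right h hq.le
  have c2 : 0 < p0 * s1 - p1 * s0 := by
    have : (r0 + t * r1) * (p0 * s1 - p1 * s0) = (p0 + t * p1) * (r0 * s1 - r1 * s0)
      + (s0 + t * s1) * (p0 * r1 - p1 * r0) := by ring
    have h : 0 < (r0 + t * r1) * (p0 * s1 - p1 * s0) := by
      rw [this]; have := mul_pos hs c1; have := mul_nonneg hp.le h3; linarith
    exact pos_of_mul_pos_right h hr.le
  have np : 0 < p0 ^ 2 + p1 ^ 2 := by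
    by_contra hn
    have : p0 = 0 := by nlinarith [sq_nonneg p0, sq_nonneg p1]
    have : p1 = 0 := by nlinarith [sq_nonneg p0, sq_nonneg p1]
    simp_all
  have nr : 0 < r0 ^ 2 + r1 ^ 2 := by
    by_contra hn
    have : r0 = 0 := by nlinarith [sq_nonneg r0, sq_nonneg r1]
    have : r1 = 0 := by nlinarith [sq_nonneg r0, sq_nonneg r1]
    simp_all
  -- d = dot(p,r) - k cross(p,r)
  have i1 : (p0 * s1 - p1 * s0) * ((p0 * r0 + p1 * r1) - k * (p0 * r1 - p1 * r0))
      = (p0 ^ 2 + p1 ^ 2) * (r0 * s1 - r1 * s0) := by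
    linear_combination (p0 * r1 - p1 * r0) * e1
  have i2 : (q0 * r1 - q1 * r0) * ((p0 * r0 + p1 * r1) - k * (p0 * r1 - p1 * r0))
      = - ((r0 ^ 2 + r1 ^ 2) * (p0 * q1 - p1 * q0)) := by
    linear_combination (p0 * r1 - p1 * r0) * e2
  have d1 : 0 ≤ (p0 * r0 + p1 * r1) - k * (p0 * r1 - p1 * r0) := by
    by_contra hn
    push Not at hn
    have := mul_neg_of_pos_of_neg c2 hn
    have := mul_nonneg np.le h3
    linarith
  have d2 : (p0 * r0 + p1 * r1) - k * (p0 * r1 - p1 * r0) ≤ 0 := by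
    by_contra hn
    push Not at hn
    have := mul_pos h2 hn
    have := mul_nonneg nr.le h1
    linarith
  have d0 := le_antisymm d2 d1
  rw [d0, mul_zero] at i1 i2
  rcases h13 with h | h
  · have := mul_pos nr h; linarith
  · have := mul_pos np h; linarith

/-- Orders of parallel edges at both ends agree (scalar form, positive version).
`u₁ = b₁ - a`, `v₁ = b₁ - c`, `u₂ = b₂ - a`, `v₂ = b₂ - c`. -/
lemma noflip_pos {k t a0 a1 c0 c1 x0 x1 y0 y1 : ℝ}
    (h1 : 0 < (x0 - a0) + t * (x1 - a1)) (h2 : 0 < (x0 - c0) + t * (x1 - c1))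
    (h3 : 0 < (y0 - a0) + t * (y1 - a1)) (h4 : 0 < (y0 - c0) + t * (y1 - c1))
    (e1 : (x0 - a0) * (x0 - c0) + (x1 - a1) * (x1 - c1) =
      k * |(x0 - a0) * (x1 - c1) - (x1 - a1) * (x0 - c0)|)
    (e2 : (y0 - a0) * (y0 - c0) + (y1 - a1) * (y1 - c1) =
      k * |(y0 - a0) * (y1 - c1) - (y1 - a1) * (y0 - c0)|)
    (n1 : (x0 - a0) * (x1 - c1) - (x1 - a1) * (x0 - c0) ≠ 0)
    (n2 : (y0 - a0) * (y1 - c1) - (y1 - a1) * (y0 - c0) ≠ 0)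
    (h : 0 < (x0 - a0) * (y1 - a1) - (x1 - a1) * (y0 - a0)) :
    0 < (x0 - c0) * (y1 - c1) - (x1 - c1) * (y0 - c0) := by
  by_contra hn
  push Not at hn
  have p1 : ((c0 - a0) + t * (c1 - a1)) * ((x0 - a0) * (y1 - a1) - (x1 - a1) * (y0 - a0)) =
      ((x0 - a0) + t * (x1 - a1)) * ((y0 - a0) * (y1 - c1) - (y1 - a1) * (y0 - c0)) -
      ((y0 - a0) + t * (y1 - a1)) * ((x0 - a0) * (x1 - c1) - (x1 - a1) * (x0 - c0)) := by ring
  have p2 : ((c0 - a0) + t * (c1 - a1)) * ((x0 - c0) * (y1 - c1) - (x1 - c1) * (y0 - c0)) =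
      ((x0 - c0) + t * (x1 - c1)) * ((y0 - a0) * (y1 - c1) - (y1 - a1) * (y0 - c0)) -
      ((y0 - c0) + t * (y1 - c1)) * ((x0 - a0) * (x1 - c1) - (x1 - a1) * (x0 - c0)) := by ring
  rcases lt_or_gt_of_ne n1 with g1 | g1 <;> rcases lt_or_gt_of_ne n2 with g2 | g2
  · -- both negative
    rw [abs_of_neg g1] at e1
    rw [abs_of_neg g2] at e2
    exact nested_angle (k := k) (t := t) h4 h2 h1 h3 (by linarith) (by linarith) h.le (Or.inr h)
      (by linarith) (by linarith)
  · have q1 := mul_pos h1 g2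
    have q2 := mul_neg_of_pos_of_neg h3 g1
    have q3 := mul_pos h2 g2
    have q4 := mul_neg_of_pos_of_neg h4 g1
    have q5 : 0 < (c0 - a0) + t * (c1 - a1) := by
      by_contra hw
      push Not at hw
      have := mul_nonpos_of_nonpos_of_nonneg hw h.le
      linarith
    have := mul_nonpos_of_nonneg_of_nonpos q5.le hn
    linarith
  · have q1 := mul_neg_of_pos_of_neg h1 g2
    have q2 := mul_pos h3 g1
    have q3 := mul_neg_of_pos_of_neg h2 g2
    have q4 := mul_pos h4 g1
    have q5 : (c0 - a0) + t * (c1 - a1) < 0 := by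
      by_contra hw
      push Not at hw
      have := mul_nonneg hw h.le
      linarith
    have := mul_nonneg_of_nonpos_of_nonpos q5.le hn
    linarith
  · rw [abs_of_pos g1] at e1
    rw [abs_of_pos g2] at e2
    exact nested_angle (k := k) (t := t) h1 h3 h4 h2 h.le (by linarith) (by linarith) (Or.inl h)
      (by linarith) (by linarith)


/-! ### Part 3: counting in drawings of one-bend edges -/

namespace Drawing

variable {N E : Type} [Fintype N] [Fintype E]

/-- Combinatorial structure of a drawing whose edges come in pairs of legs. -/
structure Legs (D : Drawing (N ⊕ E) (E × Bool)) (foot : E × Bool → N) : Prop where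
  ends : ∀ s, (D.l s = Sum.inl (foot s) ∧ D.r s = Sum.inr s.1) ∨
    (D.l s = Sum.inr s.1 ∧ D.r s = Sum.inl (foot s))
  foot_ne : ∀ e, foot (e, false) ≠ foot (e, true)

variable {D : Drawing (N ⊕ E) (E × Bool)} {foot : E × Bool → N}

lemma zmod2_ne {x : ZMod 2} (h : x ≠ 0) : x = 1 := by
  revert h; revert x; decide

lemma Legs.bend_eq (hL : Legs D foot) (z : D.Z) (e : E) : z.1 (e, false) = z.1 (e, true) := by
  classical
  have h := congrFun (LinearMap.mem_ker.1 z.2) (Sum.inr e)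
  change ∑ s, ind (D.l s = Sum.inr e) * z.1 s + ∑ s, ind (D.r s = Sum.inr e) * z.1 s = 0 at h
  rw [← Finset.sum_add_distrib] at h
  have h2 : ∀ s : E × Bool, ind (D.l s = Sum.inr e) * z.1 s + ind (D.r s = Sum.inr e) * z.1 s
      = if s.1 = e then z.1 s else 0 := by
    intro s
    rcases hL.ends s with ⟨h1, h2⟩ | ⟨h1, h2⟩ <;> rw [h1, h2] <;> by_cases hs : s.1 = e <;>
      simp [ind, hs]
  simp only [h2, Fintype.sum_prod_type, Fintype.sum_bool] at h
  rw [Finset.sum_eq_single e (by intro b _ hb; simp [hb]) (by simp)] at h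
  simp only [if_true] at h
  exact (CharTwo.add_eq_zero.1 h).symm

lemma Legs.foot_sum (hL : Legs D foot) (z : D.Z) (p : N) :
    ∑ e, (ind (foot (e, false) = p) + ind (foot (e, true) = p)) * z.1 (e, false) = 0 := by
  classical
  have h := congrFun (LinearMap.mem_ker.1 z.2) (Sum.inl p)
  change ∑ s, ind (D.l s = Sum.inl p) * z.1 s + ∑ s, ind (D.r s = Sum.inl p) * z.1 s = 0 at h
  rw [← Finset.sum_add_distrib] at h
  have h2 : ∀ s : E × Bool, ind (D.l s = Sum.inl p) * z.1 s + ind (D.r s = Sum.inl p) * z.1 s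
      = ind (foot s = p) * z.1 s := by
    intro s
    rcases hL.ends s with ⟨h1, h2⟩ | ⟨h1, h2⟩ <;> rw [h1, h2] <;> by_cases hs : foot s = p <;>
      simp [ind, hs]
  simp only [h2, Fintype.sum_prod_type, Fintype.sum_bool] at h
  rw [← h]
  refine Finset.sum_congr rfl (fun e _ => ?_)
  rw [← hL.bend_eq z e]; ring

open Classical in
/-- The edges on the boundary of the face `f`. -/
def T (D : Drawing (N ⊕ E) (E × Bool)) (f : D.Z → ZMod 2) : Finset E :=
  Finset.univ.filter (fun e => D.zf f (e, false) ≠ 0)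

lemma mem_T {f : D.Z → ZMod 2} {e : E} : e ∈ D.T f ↔ D.zf f (e, false) ≠ 0 := by
  simp [T]

lemma mem_T' (hD : D.Good) (hL : Legs D foot) {f : D.Z → ZMod 2} {s : E × Bool} :
    s.1 ∈ D.T f ↔ D.zf f s ≠ 0 := by
  obtain ⟨e, b⟩ := s
  rw [mem_T]
  cases b
  · rfl
  · have := hL.bend_eq ⟨_, zf_mem hD f⟩ e
    simp only at this
    rw [this]

open Classical in
lemma card_supp (hD : D.Good) (hL : Legs D foot) (f : D.Z → ZMod 2) :
    (Finset.univ.filter (fun s => D.zf f s ≠ 0)).card = 2 * (D.T f).card := by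
  have : Finset.univ.filter (fun s => D.zf f s ≠ 0) = D.T f ×ˢ (Finset.univ : Finset Bool) := by
    ext s
    rw [Finset.mem_product, mem_T' hD hL]; simp
  rw [this, Finset.card_product]; simp [mul_comm]

lemma T_sum (hD : D.Good) (hL : Legs D foot) (f : D.Z → ZMod 2) (p : N) :
    ∑ e ∈ D.T f, (ind (foot (e, false) = p) + ind (foot (e, true) = p)) = 0 := by
  classical
  have h := hL.foot_sum ⟨_, zf_mem hD f⟩ p
  rw [← h, T, Finset.sum_filter]
  refine Finset.sum_congr rfl (fun e _ => ?_)
  by_cases h : D.zf f (e, false) = 0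
  · simp [h]
  · simp [zmod2_ne h]

lemma T_card (hD : D.Good) (hL : Legs D foot) {f : D.Z → ZMod 2} (hf : f ∈ D.F) :
    2 ≤ (D.T f).card := by
  by_contra hn
  push Not at hn
  have h0 : (D.T f).card ≠ 0 := by
    intro h0
    rw [Finset.card_eq_zero] at h0
    apply mem_F.1 hf
    funext s
    by_contra hs
    have := (mem_T' hD hL).2 hs
    rw [h0] at this; simp at this
  obtain ⟨e, he⟩ := Finset.card_eq_one.1 (show (D.T f).card = 1 by omega)
  have := T_sum hD hL f (foot (e, false))
  rw [he, Finset.sum_singleton, ind_true rfl, ind_false (hL.foot_ne e).symm] at this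
  simp at this

/-- A two-sided face is bounded by two parallel edges. -/
lemma T_two (hD : D.Good) (hL : Legs D foot) {f : D.Z → ZMod 2} {e₁ e₂ : E} (hne : e₁ ≠ e₂)
    (hT : ∀ e, e ∈ D.T f ↔ e = e₁ ∨ e = e₂) :
    ∃ b', ∀ b, foot (e₁, b) = foot (e₂, b ^^ b') := by
  classical
  have hT' : D.T f = {e₁, e₂} := by ext e; rw [hT]; simp
  have h : ∀ p, _ := T_sum hD hL f
  simp only [hT', Finset.sum_pair hne] at h
  have h1 := hL.foot_ne e₁
  have h2 := hL.foot_ne e₂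
  have k1 := h (foot (e₁, false))
  have k2 := h (foot (e₁, true))
  rw [ind_true rfl, ind_false h1.symm] at k1
  rw [ind_true rfl, ind_false h1] at k2
  have k3 : foot (e₂, false) = foot (e₁, false) ∨ foot (e₂, true) = foot (e₁, false) := by
    by_contra hn; push Not at hn
    rw [ind_false hn.1, ind_false hn.2] at k1; simp at k1
  have k4 : foot (e₂, false) = foot (e₁, true) ∨ foot (e₂, true) = foot (e₁, true) := by
    by_contra hn; push Not at hn
    rw [ind_false hn.1, ind_false hn.2] at k2; simp at k2
  rcases k3 with k3 | k3
  · refine ⟨false, ?_⟩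
    rcases k4 with k4 | k4
    · exact absurd (k3.symm.trans k4) h1
    · intro b; cases b
      · exact k3.symm
      · exact k4.symm
  · refine ⟨true, ?_⟩
    rcases k4 with k4 | k4
    · intro b; cases b
      · exact k3.symm
      · exact k4.symm
    · exact absurd (k3.symm.trans k4) h1

/-- `t` is next to and above `g` at a common end of the same type. -/
def Above (D : Drawing (N ⊕ E) (E × Bool)) (g t : E × Bool) : Prop :=
  (D.l g = D.l t ∧ D.slope g < D.slope t) ∨ (D.r g = D.r t ∧ D.slope t < D.slope g)

lemma Legs.asymm (hL : Legs D foot) {g t : E × Bool} (hne : g.1 ≠ t.1) (h1 : D.Above g t)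
    (h2 : D.Above t g) : False := by
  rcases h1 with h1 | h1 <;> rcases h2 with h2 | h2
  · linarith [h1.2, h2.2]
  · rcases hL.ends g with h | h <;> rcases hL.ends t with h' | h'
    · have := h.2.symm.trans (h2.1.symm.trans h'.2)
      exact hne (Sum.inr_injective this)
    · have := h.1.symm.trans (h1.1.trans h'.1)
      simp at this
    · have := h.1.symm.trans (h1.1.trans h'.1)
      simp at this
    · have := h.1.symm.trans (h1.1.trans h'.1)
      exact hne (Sum.inr_injective this)
  · rcases hL.ends g with h | h <;> rcases hL.ends t with h' | h'
    · have := h.2.symm.trans (h1.1.trans h'.2)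
      exact hne (Sum.inr_injective this)
    · have := h.2.symm.trans (h1.1.trans h'.2)
      simp at this
    · have := h.2.symm.trans (h1.1.trans h'.2)
      simp at this
    · have := h.1.symm.trans (h2.1.symm.trans h'.1)
      exact hne (Sum.inr_injective this)
  · linarith [h1.2, h2.2]

lemma ind_eq_iff {p q : Prop} (h : ind p = ind q) : p ↔ q := by
  by_cases p <;> by_cases q <;> simp_all [ind]

/-- If nothing on the boundary of `f` is above the leg `g` at its foot, and the foot is not
labelled `f`, then the upper side of `g` is not labelled `f`. -/
lemma topmost (hD : D.Good) (hL : Legs D foot) {f : D.Z → ZMod 2} {g : E × Bool}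
    (hg : ∀ t, t.1 ∈ D.T f → foot t = foot g → ¬ D.Above g t)
    (hA : D.A (Sum.inl (foot g)) ≠ f) : D.Wp g ≠ f := by
  classical
  rcases hL.ends g with h | h
  · have k := partial_l hD f g
    rw [Finset.sum_eq_zero, h.1] at k
    · intro hw
      rw [ind_true hw, ind_false hA] at k
      simp at k
    · intro t ht
      simp only [Finset.mem_filter, Finset.mem_univ, true_and] at ht
      by_contra hz
      have hf : foot t = foot g := by
        rcases hL.ends t with h' | h'
        · have := h'.1.symm.trans (ht.1.trans h.1); exact Sum.inl_injective this
        · have := h'.1.symm.trans (ht.1.trans h.1); simp at this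
      exact hg t ((mem_T' hD hL).2 hz) hf (Or.inl ⟨ht.1.symm, ht.2⟩)
  · have k := partial_r hD f g
    rw [Finset.sum_eq_zero, h.2] at k
    · intro hw
      rw [ind_true hw, ind_false hA] at k
      simp at k
    · intro t ht
      simp only [Finset.mem_filter, Finset.mem_univ, true_and] at ht
      by_contra hz
      have hf : foot t = foot g := by
        rcases hL.ends t with h' | h'
        · have := h'.2.symm.trans (ht.1.trans h.2); simp at this
        · have := h'.2.symm.trans (ht.1.trans h.2); exact Sum.inl_injective this
      exact hg t ((mem_T' hD hL).2 hz) hf (Or.inr ⟨ht.1.symm, ht.2⟩)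

/-- At a cusp the face between the two legs is on the upper side of one of them. -/
lemma cusp_contra (hD : D.Good) (hL : Legs D foot) {f : D.Z → ZMod 2} {e : E}
    (hc : D.l (e, false) = Sum.inr e ↔ D.l (e, true) = Sum.inr e) (he : e ∈ D.T f)
    (hW : ∀ b, D.Wp (e, b) ≠ f) : False := by
  classical
  have hz : ∀ b, D.zf f (e, b) = 1 := fun b => zmod2_ne ((mem_T' hD hL (s := (e, b))).1 he)
  have key : ∀ b, D.l (e, b) = Sum.inr e → D.l (e, !b) = Sum.inr e →
      D.slope (e, b) < D.slope (e, !b) → False := by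
    intro b h1 h2 hs
    have k1 := partial_l hD f (e, !b)
    have k2 := partial_l hD f (e, b)
    have hmem : ∀ t : E × Bool, D.l t = Sum.inr e → t = (e, b) ∨ t = (e, !b) := by
      rintro ⟨e', b'⟩ ht
      rcases hL.ends (e', b') with h | h
      · have := h.1.symm.trans ht; simp at this
      · have : e' = e := Sum.inr_injective (h.1.symm.trans ht)
        subst this
        cases b <;> cases b' <;> simp
    rw [Finset.sum_eq_zero, h2, ind_false (hW _)] at k1
    · rw [Finset.sum_eq_single (e, !b), h1, ind_false (hW _), ← k1, hz] at k2
      · exact one_ne_zero k2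
      · intro t ht hne
        simp only [Finset.mem_filter, Finset.mem_univ, true_and] at ht
        rcases hmem t (ht.1.trans h1) with rfl | rfl
        · exact absurd ht.2 (lt_irrefl _)
        · exact absurd rfl hne
      · intro hn
        exfalso; apply hn
        simp only [Finset.mem_filter, Finset.mem_univ, true_and]
        exact ⟨h2.trans h1.symm, hs⟩
    · intro t ht
      simp only [Finset.mem_filter, Finset.mem_univ, true_and] at ht
      exfalso
      rcases hmem t (ht.1.trans h2) with rfl | rfl
      · linarith [ht.2]
      · exact absurd ht.2 (lt_irrefl _)
  have key' : ∀ b, D.r (e, b) = Sum.inr e → D.r (e, !b) = Sum.inr e →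
      D.slope (e, !b) < D.slope (e, b) → False := by
    intro b h1 h2 hs
    have k1 := partial_r hD f (e, !b)
    have k2 := partial_r hD f (e, b)
    have hmem : ∀ t : E × Bool, D.r t = Sum.inr e → t = (e, b) ∨ t = (e, !b) := by
      rintro ⟨e', b'⟩ ht
      rcases hL.ends (e', b') with h | h
      · have : e' = e := Sum.inr_injective (h.2.symm.trans ht)
        subst this
        cases b <;> cases b' <;> simp
      · have := h.2.symm.trans ht; simp at this
    rw [Finset.sum_eq_zero, h2, ind_false (hW _)] at k1
    · rw [Finset.sum_eq_single (e, !b), h1, ind_false (hW _), ← k1, hz] at k2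
      · exact one_ne_zero k2
      · intro t ht hne
        simp only [Finset.mem_filter, Finset.mem_univ, true_and] at ht
        rcases hmem t (ht.1.trans h1) with rfl | rfl
        · exact absurd ht.2 (lt_irrefl _)
        · exact absurd rfl hne
      · intro hn
        exfalso; apply hn
        simp only [Finset.mem_filter, Finset.mem_univ, true_and]
        exact ⟨h2.trans h1.symm, hs⟩
    · intro t ht
      simp only [Finset.mem_filter, Finset.mem_univ, true_and] at ht
      exfalso
      rcases hmem t (ht.1.trans h2) with rfl | rfl
      · linarith [ht.2]
      · exact absurd ht.2 (lt_irrefl _)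
  by_cases hl : D.l (e, false) = Sum.inr e
  · have hl' := hc.1 hl
    have hne : D.slope (e, false) ≠ D.slope (e, true) := by
      intro h
      have := slope_injOn_l hD (Sum.inr e) hl hl' h
      simp at this
    rcases lt_or_gt_of_ne hne with h | h
    · exact key false hl hl' h
    · exact key true hl' hl h
  · have hl' := fun h => hl (hc.2 h)
    have r1 : D.r (e, false) = Sum.inr e := by
      rcases hL.ends (e, false) with h | h
      · exact h.2
      · exact absurd h.1 hl
    have r2 : D.r (e, true) = Sum.inr e := by
      rcases hL.ends (e, true) with h | h
      · exact h.2
      · exact absurd h.1 hl'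
    have hne : D.slope (e, false) ≠ D.slope (e, true) := by
      intro h
      have := slope_injOn_r hD (Sum.inr e) r1 r2 h
      simp at this
    rcases lt_or_gt_of_ne hne with h | h
    · exact key' true r2 r1 h
    · exact key' false r1 r2 h

/-- Orders of parallel edges at both ends agree. -/
def NoFlip (D : Drawing (N ⊕ E) (E × Bool)) (foot : E × Bool → N) : Prop :=
  ∀ e₁ e₂ b b', e₁ ≠ e₂ → foot (e₁, b) = foot (e₂, b') → foot (e₁, !b) = foot (e₂, !b') →
    D.Above (e₁, b) (e₂, b') → D.Above (e₁, !b) (e₂, !b')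

lemma two_face (hD : D.Good) (hL : Legs D foot)
    (hc : ∀ e, D.l (e, false) = Sum.inr e ↔ D.l (e, true) = Sum.inr e) (hN : NoFlip D foot)
    {f : D.Z → ZMod 2} (hf : (D.T f).card = 2) : ∃ v : N, D.A (Sum.inl v) = f := by
  classical
  by_contra hA
  push Not at hA
  obtain ⟨e₁, e₂, hne, hT'⟩ := Finset.card_eq_two.1 hf
  have main : ∀ e₁ e₂ : E, e₁ ≠ e₂ → (∀ e, e ∈ D.T f ↔ e = e₁ ∨ e = e₂) →
      (∀ b t, foot t = foot (e₁, b) → t.1 = e₂ → ¬ D.Above (e₁, b) t) → False := by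
    intro e₁ e₂ hne hT hab
    refine cusp_contra hD hL (hc e₁) ((hT e₁).2 (Or.inl rfl)) (fun b => ?_)
    refine topmost hD hL (fun t ht hft => ?_) (hA _)
    rcases (hT _).1 ht with h | h
    · obtain ⟨e, b'⟩ := t
      simp only at h
      subst h
      have : b' = b := by
        have := hL.foot_ne e
        cases b <;> cases b' <;> first | rfl | (exfalso; first | exact this hft | exact this hft.symm)
      subst this
      rintro (h | h) <;> exact lt_irrefl _ h.2
    · exact hab b t hft h
  have hT : ∀ e, e ∈ D.T f ↔ e = e₁ ∨ e = e₂ := by intro e; rw [hT']; simp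
  have hTs : ∀ e, e ∈ D.T f ↔ e = e₂ ∨ e = e₁ := by intro e; rw [hT]; tauto
  obtain ⟨b', hb'⟩ := T_two hD hL hne hT
  have hinj : ∀ e b b', foot (e, b) = foot (e, b') → b = b' := by
    intro e b b' h
    have := hL.foot_ne e
    cases b <;> cases b' <;> first | rfl | (exfalso; first | exact this h | exact this h.symm)
  have hx : ∀ b b' : Bool, ((!b) ^^ b') = !(b ^^ b') := by decide
  by_cases hab : ∃ b, D.Above (e₁, b) (e₂, b ^^ b')
  · obtain ⟨b, hb⟩ := hab
    have h2 := hN e₁ e₂ b (b ^^ b') hne (hb' b) (by rw [hb', hx]) hb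
    have hall : ∀ b, D.Above (e₁, b) (e₂, b ^^ b') := by
      intro c
      by_cases hcb : c = b
      · subst hcb; exact hb
      · have : c = !b := by cases b <;> cases c <;> simp_all
        subst this; rw [hx]; exact h2
    apply main e₂ e₁ hne.symm hTs
    rintro b ⟨e, c⟩ hft rfl hab
    rw [hb'] at hft
    have := hinj _ _ _ hft
    subst this
    exact hL.asymm hne (hall c) hab
  · push Not at hab
    apply main e₁ e₂ hne hT
    rintro b ⟨e, c⟩ hft rfl h

    rw [hb'] at hft
    have := hinj _ _ _ hft
    subst this
    exact hab b h

/-- Counting: the number of edges is at most `3n - 6` plus the number of two-sided faces. -/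
lemma count (hD : D.Good) (hL : Legs D foot) (hn : 3 ≤ Fintype.card N) (k : ℕ)
    (hk : ((D.F).filter (fun f => (D.T f).card = 2)).card ≤ k) :
    Fintype.card E + 6 ≤ 3 * Fintype.card N + k := by
  classical
  have : Nonempty N := Fintype.card_pos_iff.1 (by omega)
  have h1 := D.dim_le
  rw [Fintype.card_sum, Fintype.card_prod, Fintype.card_bool] at h1
  by_cases hZ : D.Z = ⊥
  · rw [hZ, finrank_bot] at h1
    omega
  · have h2 := finrank_le hZ
    have h3 := D.sum_supp_le
    simp only [card_supp hD hL, ← Finset.mul_sum] at h3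
    rw [Fintype.card_prod, Fintype.card_bool] at h3
    have h4 : 3 * D.F.card ≤ ∑ f ∈ D.F, (D.T f).card +
        ((D.F).filter (fun f => (D.T f).card = 2)).card := by
      rw [Finset.card_filter, ← Finset.sum_add_distrib, mul_comm, ← smul_eq_mul,
        ← Finset.sum_const]
      refine Finset.sum_le_sum (fun f hf => ?_)
      have := T_card hD hL hf
      split_ifs <;> omega
    omega

lemma count_simple (hD : D.Good) (hL : Legs D foot) (hn : 3 ≤ Fintype.card N)
    (hs : ∀ e₁ e₂ b', e₁ ≠ e₂ → (∀ b, foot (e₁, b) = foot (e₂, b ^^ b')) → False) :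
    Fintype.card E + 6 ≤ 3 * Fintype.card N := by
  refine count hD hL hn 0 ?_
  rw [Nat.le_zero, Finset.card_eq_zero, Finset.filter_eq_empty_iff]
  intro f hf h2
  classical
  obtain ⟨e₁, e₂, hne, hT'⟩ := Finset.card_eq_two.1 h2
  obtain ⟨b', hb'⟩ := T_two hD hL hne (by intro e; rw [hT']; simp)
  exact hs e₁ e₂ b' hne hb'

lemma count_multi (hD : D.Good) (hL : Legs D foot) (hn : 3 ≤ Fintype.card N)
    (hc : ∀ e, D.l (e, false) = Sum.inr e ↔ D.l (e, true) = Sum.inr e) (hN : NoFlip D foot) :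
    Fintype.card E + 6 ≤ 4 * Fintype.card N := by
  classical
  have := count hD hL hn (Fintype.card N) ?_
  · omega
  · calc _ ≤ (Finset.univ.image (fun v : N => D.A (Sum.inl v))).card := by
          apply Finset.card_le_card
          intro f hf
          obtain ⟨v, hv⟩ := two_face hD hL hc hN (Finset.mem_filter.1 hf).2
          exact Finset.mem_image.2 ⟨v, Finset.mem_univ _, hv⟩
      _ ≤ _ := Finset.card_image_le
      _ = _ := rfl

end Drawing


/-! ### Part 4: the drawing of a plane bend multigraph -/

/-- The sheared abscissa. -/
def lin (t : ℝ) (p : Pt) : ℝ := p 0 + t * p 1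

/-- Foot of a leg. -/
def ft (e : Pt × Pt × Pt) (b : Bool) : Pt := if b then e.2.2 else e.1

section PlaneDrawing

variable {α : ℝ} {P : Finset Pt} {E : Finset (Pt × Pt × Pt)}

def posn (P : Finset Pt) (E : Finset (Pt × Pt × Pt)) : {p // p ∈ P} ⊕ {e // e ∈ E} → Pt
  | Sum.inl p => p.1
  | Sum.inr e => e.1.2.1

lemma ft_mem (hM : IsPlaneBendMultigraph α P E) (s : {e // e ∈ E} × Bool) :
    ft s.1.1 s.2 ∈ P := by
  obtain ⟨⟨e, he⟩, b⟩ := s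
  cases b
  · exact (hM.1 e he).2.1
  · exact (hM.1 e he).2.2

def footv (hM : IsPlaneBendMultigraph α P E) (s : {e // e ∈ E} × Bool) : {p // p ∈ P} :=
  ⟨ft s.1.1 s.2, ft_mem hM s⟩

open Classical in
def pdraw (hM : IsPlaneBendMultigraph α P E) (t : ℝ) :
    Drawing ({p // p ∈ P} ⊕ {e // e ∈ E}) ({e // e ∈ E} × Bool) where
  X v := lin t (posn P E v)
  Y v := posn P E v 1
  l s := if lin t (ft s.1.1 s.2) < lin t s.1.1.2.1 then Sum.inl (footv hM s) else Sum.inr s.1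
  r s := if lin t (ft s.1.1 s.2) < lin t s.1.1.2.1 then Sum.inr s.1 else Sum.inl (footv hM s)

lemma leg_facts (h0 : 0 < α) (h1 : α < π / 2) (hM : IsPlaneBendMultigraph α P E)
    {e : Pt × Pt × Pt} (he : e ∈ E) (b : Bool) :
    ((e.2.1 - ft e b) 0 * (e.2.1 - ft e !b) 0 + (e.2.1 - ft e b) 1 * (e.2.1 - ft e !b) 1)
      = (Real.cos α / Real.sin α) * |cr (e.2.1 - ft e b) (e.2.1 - ft e !b)| ∧
      cr (e.2.1 - ft e b) (e.2.1 - ft e !b) ≠ 0 := by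
  have h := bend_facts h0 h1 (hM.1 e he).1.2
  have hs : 0 < Real.sin α := Real.sin_pos_of_pos_of_lt_pi h0 (by linarith [Real.pi_pos])
  have e1 : ((e.2.1 - e.1) 0 * (e.2.1 - e.2.2) 0 + (e.2.1 - e.1) 1 * (e.2.1 - e.2.2) 1)
      = (Real.cos α / Real.sin α) * |cr (e.2.1 - e.1) (e.2.1 - e.2.2)| := by
    rw [div_mul_eq_mul_div, eq_div_iff hs.ne', h.1]; ring
  have hcr : ∀ u v, cr u v = - cr v u := by intro u v; unfold cr; ring
  cases b
  · exact ⟨e1, h.2⟩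
  · simp only [ft, Bool.not_true, if_true, Bool.false_eq_true, if_false]
    rw [hcr, abs_neg]
    exact ⟨by rw [← e1]; ring, by simpa using h.2⟩

lemma bend_ne_ft (h0 : 0 < α) (h1 : α < π / 2) (hM : IsPlaneBendMultigraph α P E)
    {e : Pt × Pt × Pt} (he : e ∈ E) (b : Bool) : e.2.1 ≠ ft e b := by
  intro h
  have := (leg_facts h0 h1 hM he b).2
  rw [← h] at this
  simp [cr] at this

lemma endpoints_iff {e : Pt × Pt × Pt} {w : Pt} : w ∈ edgeEndpoints e ↔ ∃ b, w = ft e b := by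
  simp [edgeEndpoints, ft]

lemma bendImage_iff {e : Pt × Pt × Pt} {w : Pt} :
    w ∈ bendImage e ↔ ∃ b, w ∈ segment ℝ (ft e b) e.2.1 := by
  simp [bendImage, ft, segment_symm ℝ e.2.2]

lemma posn_inj (h0 : 0 < α) (h1 : α < π / 2) (hM : IsPlaneBendMultigraph α P E) :
    Function.Injective (posn P E) := by
  have hbP : ∀ e ∈ E, e.2.1 ∉ P := by
    intro e he hp
    have := hM.2.2.1 e he _ hp (bendImage_iff.2 ⟨false, right_mem_segment ℝ _ _⟩)
    obtain ⟨b, hb⟩ := endpoints_iff.1 this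
    exact bend_ne_ft h0 h1 hM he b hb
  rintro (⟨p, hp⟩ | ⟨e, he⟩) (⟨q, hq⟩ | ⟨f, hf⟩) h <;> simp only [posn] at h
  · subst h; rfl
  · subst h; exact absurd hp (hbP f hf)
  · subst h; exact absurd hq (hbP e he)
  · by_contra hne
    have hne' : e ≠ f := by rintro rfl; exact hne rfl
    have := hM.2.2.2 e he f hf hne' ⟨bendImage_iff.2 ⟨false, right_mem_segment ℝ _ _⟩,
      bendImage_iff.2 ⟨false, h ▸ right_mem_segment ℝ _ _⟩⟩
    obtain ⟨b, hb⟩ := endpoints_iff.1 this.1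
    exact bend_ne_ft h0 h1 hM he b hb

variable {t : ℝ}

lemma pdraw_legs (hM : IsPlaneBendMultigraph α P E) :
    Drawing.Legs (pdraw hM t) (footv hM) := by
  constructor
  · intro s
    by_cases h : lin t (ft s.1.1 s.2) < lin t s.1.1.2.1
    · left; simp [pdraw, h]
    · right; simp [pdraw, h]
  · intro e h
    exact (hM.1 e.1 e.2).1.1 (congrArg Subtype.val h)

lemma pdraw_lr (_h0 : 0 < α) (_h1 : α < π / 2) (hM : IsPlaneBendMultigraph α P E)
    (hX : ∀ v w, lin t (posn P E v) = lin t (posn P E w) → v = w) (s) :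
    (pdraw hM t).X ((pdraw hM t).l s) < (pdraw hM t).X ((pdraw hM t).r s) := by
  by_cases h : lin t (ft s.1.1 s.2) < lin t s.1.1.2.1
  · simp only [pdraw, if_pos h]; exact h
  · simp only [pdraw, if_neg h]
    refine lt_of_le_of_ne (not_lt.1 h) (fun hh => ?_)
    have := hX _ _ hh
    simp at this

lemma exists_pt {D : ℝ} {a b : Pt} {t x : ℝ} (hab : lin t a < lin t b) (h1 : lin t a ≤ x)
    (h2 : x ≤ lin t b) (hD : D = a 1 + (b 1 - a 1) / (lin t b - lin t a) * (x - lin t a)) :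
    ∃ w ∈ segment ℝ a b, lin t w = x ∧ w 1 = D := by
  have hp : 0 < lin t b - lin t a := by linarith
  set τ := (x - lin t a) / (lin t b - lin t a) with hτ
  have t0 : 0 ≤ τ := div_nonneg (by linarith) hp.le
  have t1 : τ ≤ 1 := by rw [hτ, div_le_one hp]; linarith
  refine ⟨(1 - τ) • a + τ • b, ⟨1 - τ, τ, by linarith, t0, by ring, rfl⟩, ?_, ?_⟩
  · have : lin t ((1 - τ) • a + τ • b) = lin t a + τ * (lin t b - lin t a) := by
      simp [lin]; ring
    rw [this, hτ]; field_simp; ring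
  · simp only [PiLp.add_apply, PiLp.smul_apply, smul_eq_mul]
    rw [hD, hτ]; field_simp; ring

lemma pdraw_good (h0 : 0 < α) (h1 : α < π / 2) (hM : IsPlaneBendMultigraph α P E)
    (hX : ∀ v w, lin t (posn P E v) = lin t (posn P E w) → v = w) : (pdraw hM t).Good := by
  refine ⟨fun v w h => hX v w h, pdraw_lr h0 h1 hM hX, ?_⟩
  intro s s' hne x a1 a2 b1 b2 hH
  have key : ∀ s, (pdraw hM t).X ((pdraw hM t).l s) ≤ x → x ≤ (pdraw hM t).X ((pdraw hM t).r s) →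
      ∃ w ∈ segment ℝ (ft s.1.1 s.2) s.1.1.2.1, lin t w = x ∧ w 1 = (pdraw hM t).H s x := by
    intro s a1 a2
    obtain ⟨w, hw, hw2⟩ := exists_pt (D := (pdraw hM t).H s x) (pdraw_lr h0 h1 hM hX s) a1 a2 rfl
    refine ⟨w, ?_, hw2⟩
    rcases (pdraw_legs hM (t := t)).ends s with h | h
    · rw [h.1, h.2] at hw; exact hw
    · rw [h.1, h.2, segment_symm] at hw; exact hw
  have hends : ∀ s, ∀ v, (v = Sum.inl (footv hM s) ∨ v = Sum.inr s.1) →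
      (v = (pdraw hM t).l s ∨ v = (pdraw hM t).r s) := by
    intro s v hv
    rcases (pdraw_legs hM (t := t)).ends s with h | h
    · rw [h.1, h.2]; exact hv
    · rw [h.1, h.2]; exact hv.symm
  obtain ⟨w, hw, hwx, hwy⟩ := key s a1 a2
  obtain ⟨w', hw', hwx', hwy'⟩ := key s' b1 b2
  have hww : w = w' := by
    have h1 : w 1 = w' 1 := by rw [hwy, hwy', hH]
    apply pt_ext _ h1
    have : lin t w = lin t w' := by rw [hwx, hwx']
    unfold lin at this
    rw [h1] at this; linarith
  subst hww
  by_cases hs : s.1 = s'.1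
  · refine ⟨Sum.inr s.1, hends _ _ (Or.inr rfl), hends _ _ (Or.inr (by rw [hs])), ?_⟩
    have hb : s'.2 = !s.2 := by
      have : s'.2 ≠ s.2 := fun h => hne (Prod.ext hs h.symm)
      revert this
      cases s.2 <;> cases s'.2 <;> simp
    rw [← hs, hb] at hw'
    have := legs_inter (leg_facts h0 h1 hM s.1.2 s.2).2 hw hw'
    rw [← hwx, this]; rfl
  · have hne' : s.1.1 ≠ s'.1.1 := fun h => hs (Subtype.ext h)
    have hi := hM.2.2.2 _ s.1.2 _ s'.1.2 hne' ⟨bendImage_iff.2 ⟨_, hw⟩, bendImage_iff.2 ⟨_, hw'⟩⟩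
    have hfoot : ∀ s : {e // e ∈ E} × Bool, w ∈ segment ℝ (ft s.1.1 s.2) s.1.1.2.1 →
        w ∈ edgeEndpoints s.1.1 → w = ft s.1.1 s.2 := by
      intro s hw hwe
      obtain ⟨b, hb⟩ := endpoints_iff.1 hwe
      by_cases hbs : b = s.2
      · rw [hb, hbs]
      · have : b = !s.2 := by revert hbs; cases b <;> cases s.2 <;> simp
        rw [this] at hb
        rw [hb] at hw
        exact absurd hw (end_not_mem (leg_facts h0 h1 hM s.1.2 s.2).2)
    have f1 := hfoot s hw hi.1
    have f2 := hfoot s' hw' hi.2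
    refine ⟨Sum.inl (footv hM s), hends _ _ (Or.inl rfl), hends _ _ (Or.inl ?_), ?_⟩
    · congr 1
      exact Subtype.ext (f1.symm.trans f2)
    · rw [← hwx]
      exact congrArg (lin t) f1.symm

lemma pdraw_simple (hM : IsPlaneBendMultigraph α P E)
    (hs : ∀ e ∈ E, ∀ f ∈ E, e ≠ f → edgeEndpoints e ≠ edgeEndpoints f)
    (e₁ e₂ : {e // e ∈ E}) (b' : Bool) (hne : e₁ ≠ e₂)
    (h : ∀ b, footv hM (e₁, b) = footv hM (e₂, b ^^ b')) : False := by
  apply hs e₁.1 e₁.2 e₂.1 e₂.2 (fun h => hne (Subtype.ext h))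
  have h' : ∀ b, ft e₁.1 b = ft e₂.1 (b ^^ b') := fun b => congrArg Subtype.val (h b)
  ext w
  rw [endpoints_iff, endpoints_iff]
  constructor
  · rintro ⟨b, rfl⟩; exact ⟨_, h' b⟩
  · rintro ⟨b, rfl⟩
    refine ⟨b ^^ b', ?_⟩
    rw [h']; simp

lemma pdraw_slope (h0 : 0 < α) (h1 : α < π / 2) (hM : IsPlaneBendMultigraph α P E)
    (hX : ∀ v w, lin t (posn P E v) = lin t (posn P E w) → v = w) (s) :
    (pdraw hM t).slope s = (s.1.1.2.1 - ft s.1.1 s.2) 1 / lin t (s.1.1.2.1 - ft s.1.1 s.2) := by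
  have e : lin t (s.1.1.2.1 - ft s.1.1 s.2) = lin t s.1.1.2.1 - lin t (ft s.1.1 s.2) := by
    simp [lin]; ring
  have h := pdraw_lr h0 h1 hM hX s
  rw [e]
  unfold Drawing.slope
  rcases (pdraw_legs hM (t := t)).ends s with h | h
  · rw [h.1, h.2]; rfl
  · rw [h.1, h.2, ← neg_sub (lin t (ft s.1.1 s.2)), ← neg_sub (ft s.1.1 s.2), PiLp.neg_apply,
      neg_div_neg_eq]
    rfl

lemma pdraw_noflip (h0 : 0 < α) (h1 : α < π / 2) (hM : IsPlaneBendMultigraph α P E)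
    (hX : ∀ v w, lin t (posn P E v) = lin t (posn P E w) → v = w)
    (hc : ∀ e ∈ E, 0 < lin t (e.2.1 - e.1) * lin t (e.2.1 - e.2.2)) :
    Drawing.NoFlip (pdraw hM t) (footv hM) := by
  intro e₁ e₂ b b' hne hf1 hf2 hab
  have esub : ∀ u v : Pt, lin t (u - v) = lin t u - lin t v := by
    intro u v; simp [lin]; ring
  have hc' : ∀ e ∈ E, ∀ b, 0 < lin t (e.2.1 - ft e b) * lin t (e.2.1 - ft e !b) := by
    intro e he b
    cases b
    · exact hc e he
    · rw [mul_comm]; exact hc e he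
  have hL := pdraw_legs hM (t := t)
  have lpos : ∀ s, 0 < lin t (s.1.1.2.1 - ft s.1.1 s.2) ↔
      (pdraw hM t).l s = Sum.inl (footv hM s) := by
    intro s
    rw [esub, sub_pos]
    by_cases h : lin t (ft s.1.1 s.2) < lin t s.1.1.2.1
    · simp [pdraw, h]
    · simp [pdraw, h]
  have lneg : ∀ s, lin t (s.1.1.2.1 - ft s.1.1 s.2) < 0 ↔
      (pdraw hM t).r s = Sum.inl (footv hM s) := by
    intro s
    rw [esub, sub_neg]
    have hne : lin t (ft s.1.1 s.2) ≠ lin t s.1.1.2.1 := by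
      intro hh
      have := hX (Sum.inl (footv hM s)) (Sum.inr s.1) hh
      simp at this
    by_cases h : lin t (ft s.1.1 s.2) < lin t s.1.1.2.1
    · simp [pdraw, h, h.le]
    · simp [pdraw, h, lt_of_le_of_ne (not_lt.1 h) hne.symm]
  have g1 : ft e₁.1 b = ft e₂.1 b' := congrArg Subtype.val hf1
  have g2 : ft e₁.1 (!b) = ft e₂.1 (!b') := congrArg Subtype.val hf2
  have F1 := leg_facts h0 h1 hM e₁.2 b
  have F2 := leg_facts h0 h1 hM e₂.2 b'
  have C1 := hc' _ e₁.2 b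
  have C2 := hc' _ e₂.2 b'
  have slt : ∀ u v : Pt, 0 < lin t u * lin t v →
      (u 1 / lin t u < v 1 / lin t v ↔ 0 < cr u v) := by
    intro u v h
    have hu : lin t u ≠ 0 := by rintro h'; rw [h', zero_mul] at h; exact lt_irrefl _ h
    have hv : lin t v ≠ 0 := by rintro h'; rw [h', mul_zero] at h; exact lt_irrefl _ h
    have : v 1 / lin t v - u 1 / lin t u = cr u v / (lin t u * lin t v) := by
      rw [div_sub_div _ _ hv hu]
      congr 1
      · unfold cr lin; ring
      · ring
    rw [← sub_pos, this, div_pos_iff_of_pos_right h]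
  have bne : ∀ (p : {p // p ∈ P}) (e : {e // e ∈ E}),
    (Sum.inl p : {p // p ∈ P} ⊕ {e // e ∈ E}) ≠ Sum.inr e := by simp
  have S1 := pdraw_slope h0 h1 hM hX (e₁, b)
  have S2 := pdraw_slope h0 h1 hM hX (e₂, b')
  have S3 := pdraw_slope h0 h1 hM hX (e₁, !b)
  have S4 := pdraw_slope h0 h1 hM hX (e₂, !b')
  simp only at S1 S2 S3 S4
  rw [← g1] at S2 F2 C2
  rw [← g2] at S4 F2 C2
  have L1 := lpos (e₁, b)
  have L2 := lpos (e₂, b')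
  have L3 := lpos (e₁, !b)
  have L4 := lpos (e₂, !b')
  have N1 := lneg (e₁, b)
  have N2 := lneg (e₂, b')
  have N3 := lneg (e₁, !b)
  have N4 := lneg (e₂, !b')
  simp only at L1 L2 L3 L4 N1 N2 N3 N4
  rw [← g1] at L2 N2
  rw [← g2] at L4 N4
  rcases hab with ⟨hl, hs⟩ | ⟨hr, hs⟩
  · left
    have a1 : (pdraw hM t).l (e₁, b) = Sum.inl (footv hM (e₁, b)) := by
      rcases hL.ends (e₁, b) with h | h
      · exact h.1
      · rcases hL.ends (e₂, b') with h' | h'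
        · rw [h.1, h'.1] at hl; simp at hl
        · rw [h.1, h'.1] at hl; exact absurd (Sum.inr_injective hl) hne
    have a2 : (pdraw hM t).l (e₂, b') = Sum.inl (footv hM (e₂, b')) := by rw [← hl, a1, hf1]
    have p1 := L1.2 a1
    have p2 := L2.2 a2
    have p3 := pos_of_mul_pos_right C1 p1.le
    have p4 := pos_of_mul_pos_right C2 p2.le
    rw [L3.1 p3, L4.1 p4, hf2]
    refine ⟨rfl, ?_⟩
    rw [S3, S4, slt _ _ (mul_pos p3 p4)]
    rw [S1, S2, slt _ _ (mul_pos p1 p2)] at hs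
    exact noflip_pos (t := t) p1 p3 p2 p4 F1.1 F2.1 F1.2 F2.2 hs
  · right
    have a1 : (pdraw hM t).r (e₁, b) = Sum.inl (footv hM (e₁, b)) := by
      rcases hL.ends (e₁, b) with h | h
      · rcases hL.ends (e₂, b') with h' | h'
        · rw [h.2, h'.2] at hr; exact absurd (Sum.inr_injective hr) hne
        · rw [h.2, h'.2] at hr; simp at hr
      · exact h.2
    have a2 : (pdraw hM t).r (e₂, b') = Sum.inl (footv hM (e₂, b')) := by rw [← hr, a1, hf1]
    have p1 := N1.2 a1
    have p2 := N2.2 a2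
    have p3 : lin t (e₁.1.2.1 - ft e₁.1 (!b)) < 0 := by
      by_contra hh; push Not at hh
      linarith [mul_nonpos_of_nonpos_of_nonneg p1.le hh]
    have p4 : lin t (e₂.1.2.1 - ft e₁.1 (!b)) < 0 := by
      by_contra hh; push Not at hh
      linarith [mul_nonpos_of_nonpos_of_nonneg p2.le hh]
    rw [N3.1 p3, N4.1 p4, hf2]
    refine ⟨rfl, ?_⟩
    rw [S3, S4, slt _ _ (mul_pos_of_neg_of_neg p4 p3)]
    rw [S1, S2, slt _ _ (mul_pos_of_neg_of_neg p2 p1)] at hs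
    have F1a := F1.1
    have F1b := F1.2
    have F2a := F2.1
    have F2b := F2.2
    simp only [cr, lin, PiLp.sub_apply] at *
    have := noflip_pos (t := t) (k := Real.cos α / Real.sin α)
      (a0 := - ft e₁.1 b 0) (a1 := - ft e₁.1 b 1)
      (c0 := - ft e₁.1 (!b) 0) (c1 := - ft e₁.1 (!b) 1)
      (x0 := - e₂.1.2.1 0) (x1 := - e₂.1.2.1 1) (y0 := - e₁.1.2.1 0) (y1 := - e₁.1.2.1 1)
      (by linarith) (by linarith) (by linarith) (by linarith)
      (by convert F2a using 1
          · ring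
          · congr 2; ring)
      (by convert F1a using 1
          · ring
          · congr 2; ring)
      (by convert F2b using 1; ring) (by convert F1b using 1; ring) (by linarith)
    linarith

lemma simple_bound (h0 : 0 < α) (h1 : α < π / 2) (hG : IsPlaneBendGraph α P E)
    (hn : 3 ≤ P.card) (hX : ∀ v w, lin t (posn P E v) = lin t (posn P E w) → v = w) :
    E.card + 6 ≤ 3 * P.card := by
  have := Drawing.count_simple (pdraw_good h0 h1 hG.1 hX) (pdraw_legs hG.1) (by simpa using hn)
    (pdraw_simple hG.1 hG.2)
  simpa using this

lemma multi_bound (h0 : 0 < α) (h1 : α < π / 2) (hM : IsPlaneBendMultigraph α P E)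
    (hn : 3 ≤ P.card) (hX : ∀ v w, lin t (posn P E v) = lin t (posn P E w) → v = w)
    (hc : ∀ e ∈ E, 0 < lin t (e.2.1 - e.1) * lin t (e.2.1 - e.2.2)) :
    E.card + 6 ≤ 4 * P.card := by
  have := Drawing.count_multi (pdraw_good h0 h1 hM hX) (pdraw_legs hM) (by simpa using hn)
    (by
      intro e
      have h := hc e.1 e.2
      have esub : ∀ u v : Pt, lin t (u - v) = lin t u - lin t v := by
        intro u v; simp [lin]; ring
      rw [esub, esub] at h
      have : lin t (ft e.1 false) < lin t e.1.2.1 ↔ lin t (ft e.1 true) < lin t e.1.2.1 := by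
        rcases mul_pos_iff.1 h with h | h
        · exact ⟨fun _ => by simp only [ft, if_true]; linarith [h.2],
            fun _ => by simp only [ft, Bool.false_eq_true, if_false]; linarith [h.1]⟩
        · constructor
          · intro h'; simp only [ft, Bool.false_eq_true, if_false] at h'; linarith [h.1]
          · intro h'; simp only [ft, if_true] at h'; linarith [h.2]
      by_cases h' : lin t (ft e.1 true) < lin t e.1.2.1
      · simp [pdraw, this, h']
      · simp [pdraw, this, h']) (pdraw_noflip h0 h1 hM hX hc)
  simpa using this

end PlaneDrawing


/-! ### Part 5: choice of the direction and the upper bounds -/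

lemma pigeon {ι : Type} [Fintype ι] (bad : ι → ℕ → Prop) (m : ℕ) (hm : Fintype.card ι < m)
    (h : ∀ i s t, 1 ≤ s → s ≤ m → 1 ≤ t → t ≤ m → bad i s → bad i t → s = t) :
    ∃ t, 1 ≤ t ∧ t ≤ m ∧ ∀ i, ¬ bad i t := by
  by_contra hn
  push Not at hn
  have : Nonempty ι := (hn 1 le_rfl (by omega)).nonempty
  choose! f hf using hn
  have h1 : Set.InjOn f (Finset.Icc 1 m : Finset ℕ) := by
    intro s hs t ht hst
    simp only [Finset.coe_Icc, Set.mem_Icc] at hs ht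
    exact h (f s) s t hs.1 hs.2 ht.1 ht.2 (hf s hs.1 hs.2) (hst ▸ hf t ht.1 ht.2)
  have h2 := Finset.card_le_card_of_injOn f (s := Finset.Icc 1 m) (t := Finset.univ)
    (fun _ _ => Finset.mem_univ _) h1
  simp at h2
  omega

/-- A thin cone containing the normal direction to `(1,t)` is close to it. -/
lemma cone_normal {κ t u0 u1 v0 v1 : ℝ} (hκ : 0 < κ)
    (hd : 0 < u0 * v0 + u1 * v1)
    (hc : |u0 * v1 - u1 * v0| = κ * (u0 * v0 + u1 * v1))
    (hb : (u0 + t * u1) * (v0 + t * v1) ≤ 0) : |u0 + t * u1| ≤ κ * |u1 - t * u0| := by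
  have e1 : (1 + t ^ 2) * (u0 * v0 + u1 * v1) =
    (u0 + t * u1) * (v0 + t * v1) + (u1 - t * u0) * (v1 - t * v0) := by ring
  have e2 : (1 + t ^ 2) * (u0 * v1 - u1 * v0) =
    (u0 + t * u1) * (v1 - t * v0) - (u1 - t * u0) * (v0 + t * v1) := by ring
  set a := u0 + t * u1
  set b := v0 + t * v1
  set p := u1 - t * u0
  set q := v1 - t * v0
  set d := u0 * v0 + u1 * v1
  set c := u0 * v1 - u1 * v0
  have h1 : 0 < 1 + t ^ 2 := by positivity
  have hpq : 0 < p * q := by have := mul_pos h1 hd; linarith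
  have hq : 0 < |q| := abs_pos.2 (fun h => by rw [h, mul_zero] at hpq; exact lt_irrefl _ hpq)
  have h3 : 0 ≤ (a * q) * (-(p * b)) := by
    have : (a * q) * (-(p * b)) = (p * q) * (-(a * b)) := by ring
    rw [this]; exact mul_nonneg hpq.le (by linarith)
  have h4 : |a * q| ≤ |a * q - p * b| := by
    rw [sub_eq_add_neg]
    apply sq_le_sq.1
    nlinarith [sq_nonneg (p * b)]
  have h5 : |a * q - p * b| = (1 + t ^ 2) * (κ * d) := by
    rw [← e2, abs_mul, abs_of_pos h1, hc]
  have h6 : (1 + t ^ 2) * d ≤ |p| * |q| := by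
    rw [← abs_mul, abs_of_pos hpq]; linarith
  have h7 : |a| * |q| ≤ (κ * |p|) * |q| := by
    rw [← abs_mul]
    calc _ ≤ _ := h4
      _ = κ * ((1 + t ^ 2) * d) := by rw [h5]; ring
      _ ≤ κ * (|p| * |q|) := mul_le_mul_of_nonneg_left h6 hκ.le
      _ = _ := by ring
  exact le_of_mul_le_mul_right h7 hq

lemma cone_two {κ m s t u0 u1 : ℝ} (hκ : 0 < κ) (hm : 1 ≤ m) (hκm : κ * (8 * m ^ 2) < 1)
    (hs0 : 1 ≤ s) (hsm : s ≤ m) (ht0 : 1 ≤ t) (htm : t ≤ m) (hst : s + 1 ≤ t)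
    (h1 : |u0 + s * u1| ≤ κ * |u1 - s * u0|) (h2 : |u0 + t * u1| ≤ κ * |u1 - t * u0|) :
    u0 = 0 ∧ u1 = 0 := by
  have hb : ∀ s, 1 ≤ s → s ≤ m → |u1 - s * u0| ≤ |u1| + m * |u0| := by
    intro s h1 h2
    calc _ ≤ |u1| + |s * u0| := abs_sub _ _
      _ = |u1| + s * |u0| := by rw [abs_mul, abs_of_pos (by linarith : 0 < s)]
      _ ≤ _ := by have := mul_le_mul_of_nonneg_right h2 (abs_nonneg u0); linarith
  have b1 := (mul_le_mul_of_nonneg_left (hb s hs0 hsm) hκ.le)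
  have b2 := (mul_le_mul_of_nonneg_left (hb t ht0 htm) hκ.le)
  have a1 : |u1| ≤ 2 * (κ * (|u1| + m * |u0|)) := by
    have : |(t - s) * u1| ≤ |u0 + t * u1| + |u0 + s * u1| := by
      have := abs_sub (u0 + t * u1) (u0 + s * u1)
      rwa [show u0 + t * u1 - (u0 + s * u1) = (t - s) * u1 by ring] at this
    rw [abs_mul, abs_of_pos (by linarith : 0 < t - s)] at this
    have h3 : 1 * |u1| ≤ (t - s) * |u1| := mul_le_mul_of_nonneg_right (by linarith) (abs_nonneg _)
    linarith
  have a2 : |u0| ≤ m * |u1| + κ * (|u1| + m * |u0|) := by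
    have : |u0| ≤ |u0 + s * u1| + |s * u1| := by
      have := abs_sub (u0 + s * u1) (s * u1)
      simpa using this
    rw [abs_mul, abs_of_pos (by linarith : 0 < s)] at this
    have := mul_le_mul_of_nonneg_right hsm (abs_nonneg u1)
    linarith
  have n0 := abs_nonneg u0
  have n1 := abs_nonneg u1
  have mm : m ≤ m ^ 2 := by nlinarith
  have k1 : κ * m ≤ 1 / 8 := by nlinarith
  have k2 : κ ≤ 1 / 8 := by nlinarith
  have a3 : |u0| ≤ 2 * m * |u1| := by
    have q1 : κ * m * |u0| ≤ 1 / 8 * |u0| := mul_le_mul_of_nonneg_right k1 n0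
    have q2 : κ * |u1| ≤ 1 / 8 * |u1| := mul_le_mul_of_nonneg_right k2 n1
    have q3 : 1 * |u1| ≤ m * |u1| := mul_le_mul_of_nonneg_right hm n1
    nlinarith
  have a4 : |u1| ≤ (κ * (8 * m ^ 2)) * (3 / 4) * |u1| := by
    have q : κ * m * |u0| ≤ κ * m * (2 * m * |u1|) := mul_le_mul_of_nonneg_left a3 (by positivity)
    have q2 : κ * 1 * |u1| ≤ κ * m ^ 2 * |u1| := by gcongr; nlinarith
    nlinarith
  have z1 : |u1| = 0 := by nlinarith
  have z0 : |u0| = 0 := by rw [z1] at a3; linarith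
  exact ⟨abs_eq_zero.1 z0, abs_eq_zero.1 z1⟩

lemma exists_dir {α : ℝ} {P : Finset Pt} {E : Finset (Pt × Pt × Pt)} (h0 : 0 < α) (h1 : α < π / 2)
    (hM : IsPlaneBendMultigraph α P E) (m : ℕ) (hm : (P.card + E.card) ^ 2 + E.card < m)
    (hα : Real.tan α * (8 * (m:ℝ) ^ 2) < 1) :
    ∃ t : ℝ, (∀ v w, lin t (posn P E v) = lin t (posn P E w) → v = w) ∧
      (∀ e ∈ E, 0 < lin t (e.2.1 - e.1) * lin t (e.2.1 - e.2.2)) := by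
  classical
  have hs : 0 < Real.sin α := Real.sin_pos_of_pos_of_lt_pi h0 (by linarith [Real.pi_pos])
  have hc : 0 < Real.cos α := Real.cos_pos_of_mem_Ioo ⟨by linarith, h1⟩
  have hm1 : (1:ℝ) ≤ m := by exact_mod_cast (by omega : 1 ≤ m)
  let V := {p // p ∈ P} ⊕ {e // e ∈ E}
  let bad : (V × V) ⊕ {e // e ∈ E} → ℕ → Prop := fun i t =>
    match i with
    | Sum.inl vw => vw.1 ≠ vw.2 ∧ lin t (posn P E vw.1) = lin t (posn P E vw.2)
    | Sum.inr e => lin t (e.1.2.1 - e.1.1) * lin t (e.1.2.1 - e.1.2.2) ≤ 0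
  obtain ⟨t, -, -, ht⟩ := pigeon bad m (by simp [V]; nlinarith) (by
    intro i s t hs1 hsm ht1 htm bs bt
    have hs1' : (1:ℝ) ≤ s := by exact_mod_cast hs1
    have ht1' : (1:ℝ) ≤ t := by exact_mod_cast ht1
    have hsm' : (s:ℝ) ≤ m := by exact_mod_cast hsm
    have htm' : (t:ℝ) ≤ m := by exact_mod_cast htm
    rcases i with ⟨v, w⟩ | ⟨e, he⟩
    · obtain ⟨hne, h1'⟩ := bs
      obtain ⟨-, h2'⟩ := bt
      simp only [lin] at h1' h2' hne
      by_contra hst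
      have hst' : (s:ℝ) - t ≠ 0 := sub_ne_zero.2 (by exact_mod_cast hst)
      have e1 : posn P E v 1 = posn P E w 1 := by
        have : ((s:ℝ) - t) * (posn P E v 1 - posn P E w 1) = 0 := by linarith
        rcases mul_eq_zero.1 this with h | h
        · exact absurd h hst'
        · linarith
      have e0 : posn P E v 0 = posn P E w 0 := by rw [e1] at h1'; linarith
      exact hne (posn_inj h0 h1 hM (pt_ext e0 e1))
    · obtain ⟨f1, f2⟩ := bend_facts h0 h1 (hM.1 e he).1.2
      have hκ : 0 < Real.tan α := Real.tan_pos_of_pos_of_lt_pi_div_two h0 h1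
      have hc1 : |cr (e.2.1 - e.1) (e.2.1 - e.2.2)| = Real.tan α *
          ((e.2.1 - e.1) 0 * (e.2.1 - e.2.2) 0 + (e.2.1 - e.1) 1 * (e.2.1 - e.2.2) 1) := by
        rw [Real.tan_eq_sin_div_cos, div_mul_eq_mul_div, eq_div_iff hc.ne', ← f1]; ring
      have hd : 0 < (e.2.1 - e.1) 0 * (e.2.1 - e.2.2) 0 + (e.2.1 - e.1) 1 * (e.2.1 - e.2.2) 1 := by
        have : 0 < Real.tan α * ((e.2.1 - e.1) 0 * (e.2.1 - e.2.2) 0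
          + (e.2.1 - e.1) 1 * (e.2.1 - e.2.2) 1) := by rw [← hc1]; exact abs_pos.2 f2
        exact pos_of_mul_pos_right this hκ.le
      have n1 := cone_normal (t := s) hκ hd hc1 bs
      have n2 := cone_normal (t := t) hκ hd hc1 bt
      by_contra hst
      have : (e.2.1 - e.1) 0 = 0 ∧ (e.2.1 - e.1) 1 = 0 := by
        rcases lt_or_gt_of_ne hst with h | h
        · exact cone_two hκ hm1 hα hs1' hsm' ht1' htm' (by exact_mod_cast h) n1 n2
        · exact cone_two hκ hm1 hα ht1' htm' hs1' hsm' (by exact_mod_cast h) n2 n1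
      rw [this.1, this.2] at hd
      simp at hd)
  refine ⟨t, fun v w hvw => ?_, fun e he => ?_⟩
  · by_contra hne
    exact ht (Sum.inl (v, w)) ⟨hne, hvw⟩
  · have := ht (Sum.inr ⟨e, he⟩)
    exact not_le.1 this

lemma multi_subset {α : ℝ} {P : Finset Pt} {E E' : Finset (Pt × Pt × Pt)} (h : E' ⊆ E)
    (hM : IsPlaneBendMultigraph α P E) : IsPlaneBendMultigraph α P E' :=
  ⟨fun e he => hM.1 e (h he), fun e he f hf => hM.2.1 e (h he) f (h hf),
    fun e he => hM.2.2.1 e (h he), fun e he f hf => hM.2.2.2 e (h he) f (h hf)⟩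

lemma upper_bounds {α : ℝ} {P : Finset Pt} (h0 : 0 < α) (h1 : α < π / 2) (hn : 3 ≤ P.card)
    (m : ℕ) (hm : (5 * P.card) ^ 2 + 4 * P.card < m)
    (hα : Real.tan α * (8 * (m:ℝ) ^ 2) < 1) :
    (∀ E, IsPlaneBendGraph α P E → E.card ≤ 3 * P.card - 6) ∧
    (∀ E, IsPlaneBendMultigraph α P E → E.card ≤ 4 * P.card - 6) := by
  have hm' : ∀ E' : Finset (Pt × Pt × Pt), E'.card ≤ 4 * P.card →
      (P.card + E'.card) ^ 2 + E'.card < m := by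
    intro E' h
    have : (P.card + E'.card) ^ 2 ≤ (5 * P.card) ^ 2 := Nat.pow_le_pow_left (by omega) 2
    omega
  constructor
  · intro E hE
    by_contra hlt
    obtain ⟨E', hE', hc⟩ := Finset.exists_subset_card_eq (s := E) (n := 3 * P.card - 5) (by omega)
    obtain ⟨t, ht, -⟩ := exists_dir h0 h1 (multi_subset hE' hE.1) m (hm' _ (by omega)) hα
    have := simple_bound h0 h1 (P := P) (E := E')
      ⟨multi_subset hE' hE.1, fun e he f hf => hE.2 e (hE' he) f (hE' hf)⟩ hn ht
    omega
  · intro E hE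
    by_contra hlt
    obtain ⟨E', hE', hc⟩ := Finset.exists_subset_card_eq (s := E) (n := 4 * P.card - 5) (by omega)
    obtain ⟨t, ht, ht2⟩ := exists_dir h0 h1 (multi_subset hE' hE) m (hm' _ (by omega)) hα
    have := multi_bound h0 h1 (P := P) (E := E') (multi_subset hE' hE) hn ht ht2
    omega


/-! ### Part 6: scalar core of the construction -/

namespace Cons

/-- Scaled configuration of feet. -/
structure Cfg (n : ℕ) (x z : ℕ → ℝ) (g W θ : ℝ) : Prop where
  gap : ∀ i j, i < j → j < n → x i + g ≤ x j
  wid : ∀ i j, i < n → j < n → x j - x i ≤ W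
  hz : ∀ i, i < n → |z i| ≤ θ
  θpos : 0 < θ
  W0 : 0 ≤ W
  small : θ * (8 * W + 32) ≤ g
  θ1 : θ ≤ 1 / 8

/-- Parameters of an edge: tilts of the two legs and height of the apex. -/
structure EOK (x z : ℕ → ℝ) (W θ : ℝ) (i j : ℕ) (ε ρ H : ℝ) : Prop where
  e0 : 0 ≤ ε
  e1 : ε ≤ θ
  r0 : 1 - 2 * θ ≤ ρ
  r1 : ρ ≤ 1
  ap : x i + ε * (H - z i) = x j - ρ * (H - z j)
  Hle : H ≤ 2 * W + 2
  Hgt : θ < H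

/-- `(a,Y)` lies on the edge. -/
def On (x z : ℕ → ℝ) (i j : ℕ) (ε ρ H a Y : ℝ) : Prop :=
  Y ≤ H ∧ ((z i ≤ Y ∧ a = x i + ε * (Y - z i)) ∨ (z j ≤ Y ∧ a = x j - ρ * (Y - z j)))

variable {n : ℕ} {x z : ℕ → ℝ} {g W θ : ℝ} {i j k l : ℕ} {ε ρ H ε' ρ' H' a Y : ℝ}

lemma between (h : EOK x z W θ i j ε ρ H) (ht : θ ≤ 1 / 8) (hon : On x z i j ε ρ H a Y) :
    x i + ε * (Y - z i) ≤ a ∧ a ≤ x j - ρ * (Y - z j) := by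
  obtain ⟨hY, hon⟩ := hon
  have h1 := h.ap
  have h2 : 0 ≤ (ε + ρ) * (H - Y) := mul_nonneg (by linarith [h.e0, h.r0]) (by linarith)
  rcases hon with ⟨-, ha⟩ | ⟨-, ha⟩
  · exact ⟨ha.ge, by rw [ha]; nlinarith⟩
  · exact ⟨by rw [ha]; nlinarith, ha.le⟩

lemma low (hC : Cfg n x z g W θ) (hi : i < n) (hj : j < n) (hon : On x z i j ε ρ H a Y) :
    -θ ≤ Y := by
  have h1 := abs_le.1 (hC.hz i hi)
  have h2 := abs_le.1 (hC.hz j hj)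
  rcases hon.2 with ⟨h, -⟩ | ⟨h, -⟩ <;> linarith

/-- Near the bottom, a point of the edge is close to a foot below it. -/
lemma near (hC : Cfg n x z g W θ) (hi : i < n) (hj : j < n) (h : EOK x z W θ i j ε ρ H)
    (hon : On x z i j ε ρ H a Y) (hY : Y ≤ θ) :
    ∃ v, (v = i ∨ v = j) ∧ z v ≤ Y ∧ |a - x v| ≤ 2 * θ ∧ (Y = z v → a = x v) := by
  have h1 := abs_le.1 (hC.hz i hi)
  have h2 := abs_le.1 (hC.hz j hj)
  have ht := hC.θ1
  have tp := hC.θpos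
  rcases hon.2 with ⟨hy, ha⟩ | ⟨hy, ha⟩
  · refine ⟨i, Or.inl rfl, hy, ?_, fun hh => by rw [ha, hh]; ring⟩
    have p1 : ε * (Y - z i) ≤ 1 * (2 * θ) :=
      mul_le_mul (by linarith [h.e1]) (by linarith) (by linarith) (by norm_num)
    have p2 := mul_nonneg h.e0 (sub_nonneg.2 hy)
    rw [abs_le]; constructor <;> linarith
  · refine ⟨j, Or.inr rfl, hy, ?_, fun hh => by rw [ha, hh]; ring⟩
    have p1 : ρ * (Y - z j) ≤ 1 * (2 * θ) :=
      mul_le_mul h.r1 (by linarith) (by linarith) (by norm_num)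
    have p2 : 0 ≤ ρ * (Y - z j) := mul_nonneg (by linarith [h.r0]) (sub_nonneg.2 hy)
    rw [abs_le]; constructor <;> linarith

lemma gap_small (hC : Cfg n x z g W θ) : 32 * θ ≤ g := by
  have := mul_nonneg hC.θpos.le hC.W0
  linarith [hC.small]

lemma idx_eq (hC : Cfg n x z g W θ) (hi : i < n) (hj : j < n) (h : |x i - x j| ≤ 4 * θ) :
    i = j := by
  have hg := gap_small hC
  have tp := hC.θpos
  have h := abs_le.1 h
  rcases lt_trichotomy i j with hij | hij | hij
  · have := hC.gap i j hij hj; linarith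
  · exact hij
  · have := hC.gap j i hij hi; linarith

lemma vertex (hC : Cfg n x z g W θ) (hi : i < n) (hj : j < n) (h : EOK x z W θ i j ε ρ H)
    (hk : k < n) (hon : On x z i j ε ρ H (x k) (z k)) : k = i ∨ k = j := by
  obtain ⟨v, hv, -, h2, -⟩ := near hC hi hj h hon (abs_le.1 (hC.hz k hk)).2
  have tp := hC.θpos
  have hvn : v < n := by rcases hv with rfl | rfl <;> assumption
  have := idx_eq hC hk hvn (by linarith)
  rcases hv with rfl | rfl
  · exact Or.inl this
  · exact Or.inr this

lemma disj (hC : Cfg n x z g W θ) (hij : i < j) (hjk : j ≤ k) (hkl : k < l) (hl : l < n)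
    (h : EOK x z W θ i j ε ρ H) (h' : EOK x z W θ k l ε' ρ' H')
    (hon : On x z i j ε ρ H a Y) (hon' : On x z k l ε' ρ' H' a Y) :
    j = k ∧ a = x j ∧ Y = z j := by
  have hg := gap_small hC
  have tp := hC.θpos
  have t1 := hC.θ1
  have b1 := (between h t1 hon).2
  have b2 := (between h' t1 hon').1
  have lo := low hC (by omega) (by omega) hon
  have hzj := abs_le.1 (hC.hz j (by omega))
  have hzk := abs_le.1 (hC.hz k (by omega))
  have r0 := h.r0
  rcases hjk.lt_or_eq with hlt | rfl
  · exfalso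
    have := hC.gap j k hlt (by omega)
    have p1 : ρ * (z j - Y) ≤ 2 * θ := by
      by_cases hs : 0 ≤ z j - Y
      · calc ρ * (z j - Y) ≤ 1 * (z j - Y) := mul_le_mul_of_nonneg_right h.r1 hs
          _ ≤ _ := by linarith
      · have := mul_nonpos_of_nonneg_of_nonpos (show 0 ≤ ρ by linarith) (not_le.1 hs).le
        linarith
    have p2 : ε' * (z k - Y) ≤ 2 * θ := by
      by_cases hs : 0 ≤ z k - Y
      · calc ε' * (z k - Y) ≤ 1 * (z k - Y) := mul_le_mul_of_nonneg_right (by linarith [h'.e1]) hs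
          _ ≤ _ := by linarith
      · have := mul_nonpos_of_nonneg_of_nonpos h'.e0 (not_le.1 hs).le
        linarith
    linarith
  · have hle : Y ≤ z j := by
      by_contra hn
      push Not at hn
      have := mul_pos (show 0 < ρ by linarith) (sub_pos.2 hn)
      have := mul_nonneg h'.e0 (sub_pos.2 hn).le
      linarith
    obtain ⟨v, hv, hv1, hv2, hv3⟩ := near hC (by omega) (by omega) h hon (by linarith)
    obtain ⟨u, hu, hu1, hu2, hu3⟩ := near hC (by omega) (by omega) h' hon' (by linarith)
    have hvu : v = u := by
      apply idx_eq hC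
      · rcases hv with rfl | rfl <;> omega
      · rcases hu with rfl | rfl <;> omega
      · have := abs_le.1 hv2
        have := abs_le.1 hu2
        rw [abs_le]; constructor <;> linarith
    have hvj : v = j := by
      rcases hv with rfl | rfl
      · rcases hu with hu | hu <;> omega
      · rfl
    subst hvj
    have hY : Y = z v := le_antisymm hle hv1
    exact ⟨rfl, hv3 hY, hY⟩

lemma nested (hC : Cfg n x z g W θ) (hik : i ≤ k) (hkl : k < l) (hlj : l ≤ j) (hj : j < n)
    (h : EOK x z W θ i j ε ρ H) (h' : EOK x z W θ k l ε' ρ' H')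
    (hε : i = k → ε < ε') (hρ : l = j → ρ < ρ')
    (hon : On x z i j ε ρ H a Y) (hon' : On x z k l ε' ρ' H' a Y) :
    (i = k ∧ a = x i ∧ Y = z i) ∨ (j = l ∧ a = x j ∧ Y = z j) := by
  have hg := gap_small hC
  have tp := hC.θpos
  have t1 := hC.θ1
  obtain ⟨b1, b2⟩ := between h' t1 hon'
  have lo := low hC (by omega) (by omega) hon
  have hi' : Y ≤ 2 * W + 2 := hon'.1.trans h'.Hle
  have W0 := hC.W0
  have tW := mul_nonneg tp.le W0
  have tt : θ * θ ≤ θ * 1 := mul_le_mul_of_nonneg_left (by linarith) tp.le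
  have sm := hC.small
  rcases hon.2 with ⟨hy, ha⟩ | ⟨hy, ha⟩
  · rcases hik.lt_or_eq with hlt | rfl
    · exfalso
      have := hC.gap i k hlt (by omega)
      have hzi := abs_le.1 (hC.hz i (by omega))
      have hzk := abs_le.1 (hC.hz k (by omega))
      have p1 : ε * (Y - z i) ≤ θ * (2 * W + 2 + θ) :=
        mul_le_mul h.e1 (by linarith) (by linarith) tp.le
      have p2 : ε' * (z k - Y) ≤ 2 * θ := by
        by_cases hs : 0 ≤ z k - Y
        · calc ε' * (z k - Y) ≤ 1 * (z k - Y) := mul_le_mul_of_nonneg_right (by linarith [h'.e1]) hs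
            _ ≤ _ := by linarith
        · have := mul_nonpos_of_nonneg_of_nonpos h'.e0 (not_le.1 hs).le
          linarith
      nlinarith
    · left
      have hY : Y = z i := by
        by_contra hne
        have hlt : z i < Y := lt_of_le_of_ne hy (Ne.symm hne)
        have := mul_pos (sub_pos.2 (hε rfl)) (sub_pos.2 hlt)
        nlinarith
      exact ⟨rfl, by rw [ha, hY]; ring, hY⟩
  · rcases hlj.lt_or_eq with hlt | rfl
    · exfalso
      have := hC.gap l j hlt (by omega)
      have hzj := abs_le.1 (hC.hz j (by omega))
      have hzl := abs_le.1 (hC.hz l (by omega))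
      have p1 : (ρ - ρ') * (Y + θ) ≤ 2 * θ * (2 * W + 2 + θ) := by
        by_cases hs : 0 ≤ ρ - ρ'
        · exact mul_le_mul (by linarith [h.r1, h'.r0]) (by linarith) (by linarith) (by linarith)
        · have := mul_nonpos_of_nonpos_of_nonneg (not_le.1 hs).le (show 0 ≤ Y + θ by linarith)
          have : 0 ≤ 2 * θ * (2 * W + 2 + θ) := by positivity
          linarith
      have p2 : - (2 * θ) ≤ ρ * (z j + θ) - 2 * θ := by
        have : 0 ≤ ρ * (z j + θ) := mul_nonneg (by linarith [h.r0]) (by linarith)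
        linarith
      have p3 : ρ' * (z l + θ) ≤ 1 * (2 * θ) :=
        mul_le_mul h'.r1 (by linarith) (by linarith) (by norm_num)
      nlinarith
    · right
      have hY : Y = z l := by
        by_contra hne
        have hlt : z l < Y := lt_of_le_of_ne hy (Ne.symm hne)
        have := mul_pos (sub_pos.2 (hρ rfl)) (sub_pos.2 hlt)
        nlinarith
      exact ⟨rfl, by rw [ha, hY]; ring, hY⟩

/-- The tilt of an edge. -/
def tilt (n : ℕ) (θ : ℝ) (q : ℕ × ℕ) : ℝ := if q.1 = 0 then θ * ((n - q.2 : ℕ) : ℝ) / n else 0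

/-- The tilt of the right leg. -/
def rt (δ ε : ℝ) : ℝ := (1 - ε) / (1 + δ ^ 2 * ε)

/-- Scaled apex height. -/
def apx (x z : ℕ → ℝ) (δ : ℝ) (q : ℕ × ℕ) (ε : ℝ) : ℝ :=
  (x q.2 - x q.1 + ε * z q.1 + rt δ ε * z q.2) / (ε + rt δ ε)

/-- Upper edges. -/
def IsU (n : ℕ) (q : ℕ × ℕ) : Prop :=
  (q.1 = 0 ∧ 1 ≤ q.2 ∧ q.2 < n) ∨ (1 ≤ q.1 ∧ q.2 = q.1 + 1 ∧ q.2 < n)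

lemma tilt_nonneg (ht : 0 < θ) (q : ℕ × ℕ) : 0 ≤ tilt n θ q := by
  unfold tilt; split_ifs
  · positivity
  · exact le_rfl

lemma tilt_le (ht : 0 < θ) (q : ℕ × ℕ) : tilt n θ q ≤ θ := by
  unfold tilt; split_ifs
  · apply div_le_of_le_mul₀ (by positivity) ht.le
    exact mul_le_mul_of_nonneg_left (by exact_mod_cast Nat.sub_le _ _) ht.le
  · exact ht.le

lemma rt_anti {δ : ℝ} (h0 : 0 ≤ ε) (h : ε < ε') (h1 : ε' < 1) : rt δ ε' < rt δ ε := by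
  unfold rt
  have hd := sq_nonneg δ
  have p1 : 0 < 1 + δ ^ 2 * ε := by have := mul_nonneg hd h0; linarith
  have p2 : 0 < 1 + δ ^ 2 * ε' := by have := mul_nonneg hd (h0.trans h.le); linarith
  rw [div_lt_div_iff₀ p2 p1]
  have := mul_nonneg hd (sub_pos.2 h).le
  nlinarith

lemma rt_bounds {δ : ℝ} (hd0 : 0 < δ) (hd : δ ≤ 1) (h0 : 0 ≤ ε) (h1 : ε ≤ 1 / 8) :
    1 - 2 * ε ≤ rt δ ε ∧ rt δ ε ≤ 1 := by
  unfold rt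
  have hs : δ ^ 2 ≤ 1 := by nlinarith
  have hsn := sq_nonneg δ
  have hse : δ ^ 2 * ε ≤ 1 * ε := mul_le_mul_of_nonneg_right hs h0
  have hse0 := mul_nonneg hsn h0
  have p1 : 0 < 1 + δ ^ 2 * ε := by linarith
  constructor
  · rw [le_div_iff₀ p1]
    nlinarith
  · rw [div_le_one p1]; linarith

lemma eok {δ : ℝ} (hd0 : 0 < δ) (hd : δ ≤ 1) (hC : Cfg n x z g W θ) {q : ℕ × ℕ} (hq : q.1 < q.2)
    (hn : q.2 < n) : EOK x z W θ q.1 q.2 (tilt n θ q) (rt δ (tilt n θ q))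
      (apx x z δ q (tilt n θ q)) := by
  have e0 := tilt_nonneg (n := n) hC.θpos q
  have e1 := tilt_le (n := n) hC.θpos q
  have tp := hC.θpos
  have t1 := hC.θ1
  obtain ⟨r0, r1⟩ := rt_bounds hd0 hd e0 (by linarith)
  set ε := tilt n θ q
  set ρ := rt δ ε
  have hg := gap_small hC
  have hgap := hC.gap _ _ hq hn
  have hwid := hC.wid q.1 q.2 (by omega) hn
  have z1 := abs_le.1 (hC.hz q.1 (by omega))
  have z2 := abs_le.1 (hC.hz q.2 hn)
  have hs : 0 < ε + ρ := by linarith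
  have p1 : |ε * z q.1| ≤ 1 * θ := by
    rw [abs_mul]
    exact mul_le_mul (by rw [abs_of_nonneg e0]; linarith) (hC.hz _ (by omega)) (abs_nonneg _)
      (by norm_num)
  have p2 : |ρ * z q.2| ≤ 1 * θ := by
    rw [abs_mul]
    exact mul_le_mul (by rw [abs_of_nonneg (by linarith)]; linarith) (hC.hz _ hn) (abs_nonneg _)
      (by norm_num)
  have p1 := abs_le.1 p1
  have p2 := abs_le.1 p2
  have hap : apx x z δ q ε * (ε + ρ) = x q.2 - x q.1 + ε * z q.1 + ρ * z q.2 := by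
    unfold apx; exact div_mul_cancel₀ _ hs.ne'
  refine ⟨e0, e1, by linarith, r1, by linarith, ?_, ?_⟩
  · unfold apx
    rw [div_le_iff₀ hs]
    have : (2 * W + 2) * (1 / 2) ≤ (2 * W + 2) * (ε + ρ) :=
      mul_le_mul_of_nonneg_left (by linarith) (by linarith [hC.W0])
    linarith
  · unfold apx
    rw [lt_div_iff₀ hs]
    have : θ * (ε + ρ) ≤ θ * 2 := mul_le_mul_of_nonneg_left (by linarith) tp.le
    linarith

lemma IsU.lt {q : ℕ × ℕ} (h : IsU n q) : q.1 < q.2 ∧ q.2 < n := by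
  rcases h with h | h <;> omega

/-- Distinct upper edges meet only in common feet. -/
lemma up_up {δ : ℝ} (hd0 : 0 < δ) (hd : δ ≤ 1) (hC : Cfg n x z g W θ) {q q' : ℕ × ℕ}
    (hq : IsU n q) (hq' : IsU n q') (hne : q ≠ q')
    (hon : On x z q.1 q.2 (tilt n θ q) (rt δ (tilt n θ q)) (apx x z δ q (tilt n θ q)) a Y)
    (hon' : On x z q'.1 q'.2 (tilt n θ q') (rt δ (tilt n θ q')) (apx x z δ q' (tilt n θ q')) a Y) :
    ∃ v, (v = q.1 ∨ v = q.2) ∧ (v = q'.1 ∨ v = q'.2) ∧ a = x v ∧ Y = z v := by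
  have key : ∀ q q' : ℕ × ℕ, IsU n q → IsU n q' → q ≠ q' →
    On x z q.1 q.2 (tilt n θ q) (rt δ (tilt n θ q)) (apx x z δ q (tilt n θ q)) a Y →
    On x z q'.1 q'.2 (tilt n θ q') (rt δ (tilt n θ q')) (apx x z δ q' (tilt n θ q')) a Y →
    (q.2 ≤ q'.1 ∨ (q.1 ≤ q'.1 ∧ q'.2 ≤ q.2)) →
    ∃ v, (v = q.1 ∨ v = q.2) ∧ (v = q'.1 ∨ v = q'.2) ∧ a = x v ∧ Y = z v := by
    intro q q' hq hq' hne hon hon' hc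
    have l1 := hq.lt
    have l2 := hq'.lt
    have E1 := eok hd0 hd hC l1.1 l1.2
    have E2 := eok hd0 hd hC l2.1 l2.2
    have tp := hC.θpos
    have t1 := hC.θ1
    have hnp : (0:ℝ) < n := by exact_mod_cast (by omega : 0 < n)
    rcases hc with hc | hc
    · obtain ⟨h1, h2, h3⟩ := disj hC l1.1 hc l2.1 l2.2 E1 E2 hon hon'
      exact ⟨q.2, Or.inr rfl, Or.inl h1, h2, h3⟩
    · have hr : q'.2 = q.2 → tilt n θ q' < tilt n θ q := by
        intro h
        have hne1 : q.1 ≠ q'.1 := fun hh => hne (Prod.ext hh h.symm)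
        have h0 : q.1 = 0 := by rcases hq with h | h <;> rcases hq' with h' | h' <;> omega
        have h0' : q'.1 ≠ 0 := by omega
        rw [tilt, tilt, if_neg h0', if_pos h0]
        have : (0:ℝ) < ((n - q.2 : ℕ) : ℝ) := by exact_mod_cast (by omega : 0 < n - q.2)
        positivity
      have hl : q.1 = q'.1 → tilt n θ q < tilt n θ q' := by
        intro h
        have hne1 : q.2 ≠ q'.2 := fun hh => hne (Prod.ext h hh)
        have h0 : q.1 = 0 := by rcases hq with h | h <;> rcases hq' with h' | h' <;> omega
        have h0' : q'.1 = 0 := by omega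
        rw [tilt, tilt, if_pos h0', if_pos h0]
        have : ((n - q.2 : ℕ) : ℝ) < ((n - q'.2 : ℕ) : ℝ) := by
          exact_mod_cast (by omega : n - q.2 < n - q'.2)
        gcongr
      obtain ⟨h1, h2, h3⟩ | ⟨h1, h2, h3⟩ := nested hC hc.1 l2.1 hc.2 l1.2 E1 E2 hl
        (fun h => rt_anti E2.e0 (hr h) (by linarith [E1.e1])) hon hon'
      · exact ⟨q.1, Or.inl rfl, Or.inl h1, h2, h3⟩
      · exact ⟨q.2, Or.inr rfl, Or.inr h1, h2, h3⟩
  have hcase : (q.2 ≤ q'.1 ∨ (q.1 ≤ q'.1 ∧ q'.2 ≤ q.2)) ∨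
      (q'.2 ≤ q.1 ∨ (q'.1 ≤ q.1 ∧ q.2 ≤ q'.2)) := by
    rcases hq with h | h <;> rcases hq' with h' | h' <;> omega
  rcases hcase with h | h
  · exact key q q' hq hq' hne hon hon' h
  · obtain ⟨v, h1, h2, h3⟩ := key q' q hq' hq hne.symm hon' hon h
    exact ⟨v, h2, h1, h3⟩

end Cons


/-! ### Part 7: the geometric construction -/

namespace Cons

/-- Transport of an edge along an isometry. -/
def mapT (Φ : Pt ≃ₗᵢ[ℝ] Pt) (e : Pt × Pt × Pt) : Pt × Pt × Pt := (Φ e.1, Φ e.2.1, Φ e.2.2)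

lemma mem_mapT {Φ : Pt ≃ₗᵢ[ℝ] Pt} {e : Pt × Pt × Pt} {w : Pt} :
    w ∈ bendImage (mapT Φ e) ↔ Φ.symm w ∈ bendImage e := by
  have hs : ∀ a b : Pt, w ∈ segment ℝ (Φ a) (Φ b) ↔ Φ.symm w ∈ segment ℝ a b := by
    intro a b
    constructor
    · rintro ⟨s, t, hs, ht, hst, rfl⟩
      exact ⟨s, t, hs, ht, hst, by simp⟩
    · rintro ⟨s, t, hs, ht, hst, h⟩
      refine ⟨s, t, hs, ht, hst, ?_⟩
      rw [← map_smul, ← map_smul, ← map_add, h]; simp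
  simp only [bendImage, mapT, mem_union, hs]

lemma mem_ends_mapT {Φ : Pt ≃ₗᵢ[ℝ] Pt} {e : Pt × Pt × Pt} {w : Pt} :
    w ∈ edgeEndpoints (mapT Φ e) ↔ Φ.symm w ∈ edgeEndpoints e := by
  simp only [edgeEndpoints, mapT, mem_insert_iff, mem_singleton_iff]
  rw [← LinearIsometryEquiv.symm_apply_eq, ← LinearIsometryEquiv.symm_apply_eq]

lemma bendEdge_mapT {Φ : Pt ≃ₗᵢ[ℝ] Pt} {e : Pt × Pt × Pt} {α : ℝ} (h : IsBendEdge α e) :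
    IsBendEdge α (mapT Φ e) := by
  refine ⟨fun h' => h.1 (Φ.injective h'), ?_⟩
  rw [← h.2]
  simp only [mapT, EuclideanGeometry.angle, vsub_eq_sub, ← map_sub]
  exact LinearIsometry.angle_map Φ.toLinearIsometry _ _

lemma mapT_inj (Φ : Pt ≃ₗᵢ[ℝ] Pt) : Function.Injective (mapT Φ) := by
  rintro ⟨a, b, c⟩ ⟨a', b', c'⟩ h
  simp only [mapT, Prod.mk.injEq, EmbeddingLike.apply_eq_iff_eq] at h
  obtain ⟨rfl, rfl, rfl⟩ := h
  rfl

open Classical in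
lemma multi_mapT (Φ : Pt ≃ₗᵢ[ℝ] Pt) {α : ℝ} {P : Finset Pt} {E : Finset (Pt × Pt × Pt)}
    (h : IsPlaneBendMultigraph α P E) :
    IsPlaneBendMultigraph α (P.image Φ) (E.image (mapT Φ)) := by
  obtain ⟨h1, h2, h3, h4⟩ := h
  refine ⟨?_, ?_, ?_, ?_⟩
  · intro e0 he0
    obtain ⟨e, he, rfl⟩ := Finset.mem_image.1 he0
    exact ⟨bendEdge_mapT (h1 e he).1, Finset.mem_image_of_mem _ (h1 e he).2.1,
      Finset.mem_image_of_mem _ (h1 e he).2.2⟩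
  · intro e0 he0 f0 hf0 hne
    obtain ⟨e, he, rfl⟩ := Finset.mem_image.1 he0
    obtain ⟨f, hf, rfl⟩ := Finset.mem_image.1 hf0
    intro hh
    apply h2 e he f hf (fun h => hne (by rw [h]))
    ext w
    have := Set.ext_iff.1 hh (Φ w)
    simpa [mem_mapT] using this
  · intro e0 he0 v0 hv0 hve
    obtain ⟨e, he, rfl⟩ := Finset.mem_image.1 he0
    obtain ⟨v, hv, rfl⟩ := Finset.mem_image.1 hv0
    rw [mem_mapT] at hve
    rw [mem_ends_mapT]
    simp only [LinearIsometryEquiv.symm_apply_apply] at hve ⊢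
    exact h3 e he v hv hve
  · intro e0 he0 f0 hf0 hne w hw
    obtain ⟨e, he, rfl⟩ := Finset.mem_image.1 he0
    obtain ⟨f, hf, rfl⟩ := Finset.mem_image.1 hf0
    rw [mem_inter_iff, mem_mapT, mem_mapT] at hw
    rw [mem_inter_iff, mem_ends_mapT, mem_ends_mapT]
    exact h4 e he f hf (fun h => hne (by rw [h])) hw

open Classical in
lemma graph_mapT (Φ : Pt ≃ₗᵢ[ℝ] Pt) {α : ℝ} {P : Finset Pt} {E : Finset (Pt × Pt × Pt)}
    (h : IsPlaneBendGraph α P E) :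
    IsPlaneBendGraph α (P.image Φ) (E.image (mapT Φ)) := by
  refine ⟨multi_mapT Φ h.1, ?_⟩
  intro e0 he0 f0 hf0 hne
  obtain ⟨e, he, rfl⟩ := Finset.mem_image.1 he0
  obtain ⟨f, hf, rfl⟩ := Finset.mem_image.1 hf0
  intro hh
  apply h.2 e he f hf (fun h => hne (by rw [h]))
  ext w
  have := Set.ext_iff.1 hh (Φ w)
  simpa [mem_ends_mapT] using this

lemma angle_of {α : ℝ} (h0 : 0 < α) (h1 : α < π / 2) {a b c : Pt}
    (hd : 0 < (b - a) 0 * (b - c) 0 + (b - a) 1 * (b - c) 1)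
    (hc : |cr (b - a) (b - c)| = Real.tan α * ((b - a) 0 * (b - c) 0 + (b - a) 1 * (b - c) 1)) :
    ∠ a b c = α := by
  have hang : ∠ a b c = InnerProductGeometry.angle (b - a) (b - c) := by
    rw [EuclideanGeometry.angle, vsub_eq_sub, vsub_eq_sub, ← neg_sub b a, ← neg_sub b c,
      InnerProductGeometry.angle_neg_neg]
  rw [hang]
  set u := b - a
  set v := b - c
  have e1 := InnerProductGeometry.cos_angle_mul_norm_mul_norm u v
  have e2 := InnerProductGeometry.sin_angle_mul_norm_mul_norm u v
  have i1 : ∀ u v : Pt, inner ℝ u v = u 0 * v 0 + u 1 * v 1 := by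
    intro u v; simp [PiLp.inner_apply, Fin.sum_univ_two]; ring
  have e3 : Real.sin (InnerProductGeometry.angle u v) * (‖u‖ * ‖v‖) = |cr u v| := by
    rw [e2, i1, i1, i1, ← Real.sqrt_sq_eq_abs]
    congr 1
    unfold cr; ring
  rw [i1] at e1
  have hN : 0 ≤ ‖u‖ * ‖v‖ := by positivity
  have hcos : 0 < Real.cos (InnerProductGeometry.angle u v) := by
    by_contra hn
    have := mul_nonpos_of_nonpos_of_nonneg (not_lt.1 hn) hN
    linarith
  have hN' : 0 < ‖u‖ * ‖v‖ := by
    rcases hN.lt_or_eq with h | h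
    · exact h
    · rw [← h, mul_zero] at e1; linarith
  have hlt : InnerProductGeometry.angle u v < π / 2 := by
    by_contra hn
    have := Real.cos_nonpos_of_pi_div_two_le_of_le (not_lt.1 hn)
      (by linarith [InnerProductGeometry.angle_le_pi u v, Real.pi_pos])
    linarith
  apply Real.tan_inj_of_lt_of_lt_pi_div_two _ hlt (by linarith) h1
  · rw [Real.tan_eq_sin_div_cos (InnerProductGeometry.angle u v), div_eq_iff hcos.ne']
    have : Real.sin (InnerProductGeometry.angle u v) * (‖u‖ * ‖v‖) =
      (Real.tan α * Real.cos (InnerProductGeometry.angle u v)) * (‖u‖ * ‖v‖) := by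
      rw [e3, hc, ← e1]; ring
    exact mul_right_cancel₀ hN'.ne' this
  · linarith [InnerProductGeometry.angle_nonneg u v, Real.pi_pos]

/-- Points of the configuration. -/
def pp (x y : ℕ → ℝ) (k : ℕ) : Pt := !₂[x k, y k]

/-- The upper edge with index `q`. -/
def upE (n : ℕ) (x y : ℕ → ℝ) (δ θ : ℝ) (q : ℕ × ℕ) : Pt × Pt × Pt :=
  (pp x y q.1,
   !₂[x q.1 + tilt n θ q * (apx x (fun k => δ * y k) δ q (tilt n θ q) - δ * y q.1),
      apx x (fun k => δ * y k) δ q (tilt n θ q) / δ],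
   pp x y q.2)

def OnU (n : ℕ) (x y : ℕ → ℝ) (δ θ : ℝ) (q : ℕ × ℕ) (w : Pt) : Prop :=
  On x (fun k => δ * y k) q.1 q.2 (tilt n θ q) (rt δ (tilt n θ q))
    (apx x (fun k => δ * y k) δ q (tilt n θ q)) (w 0) (δ * w 1)

variable {n : ℕ} {x y : ℕ → ℝ} {g W θ δ α : ℝ} {q : ℕ × ℕ}

lemma upE_on (hd0 : 0 < δ) (hd : δ ≤ 1) (hC : Cfg n x (fun k => δ * y k) g W θ)
    (hq : q.1 < q.2) (hn : q.2 < n) {w : Pt} (hw : w ∈ bendImage (upE n x y δ θ q)) :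
    OnU n x y δ θ q w := by
  have E := eok hd0 hd hC hq hn
  have z1 := abs_le.1 (hC.hz q.1 (by omega))
  have z2 := abs_le.1 (hC.hz q.2 hn)
  have hgt := E.Hgt
  have hap := E.ap
  unfold OnU upE at *
  set H := apx x (fun k => δ * y k) δ q (tilt n θ q)
  set ε := tilt n θ q
  set ρ := rt δ ε
  simp only [bendImage, mem_union] at hw
  have hH : δ * (H / δ) = H := by field_simp
  rcases hw with hw | hw
  · obtain ⟨τ, t0, t1, ht⟩ := seg_param hw
    have w0 := ht 0
    have w1 := ht 1
    simp [pp] at w0 w1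
    have hY : δ * w 1 = H - τ * (H - δ * y q.1) := by rw [w1]; linear_combination (1 - τ) * hH
    have p1 := mul_nonneg t0 (show 0 ≤ H - δ * y q.1 by linarith)
    have p2 := mul_nonneg (sub_nonneg.2 t1) (show 0 ≤ H - δ * y q.1 by linarith)
    refine ⟨by rw [hY]; linarith, Or.inl ⟨by rw [hY]; linarith, ?_⟩⟩
    rw [hY, w0]; ring
  · rw [segment_symm] at hw
    obtain ⟨τ, t0, t1, ht⟩ := seg_param hw
    have w0 := ht 0
    have w1 := ht 1
    simp [pp] at w0 w1
    have hY : δ * w 1 = H - τ * (H - δ * y q.2) := by rw [w1]; linear_combination (1 - τ) * hH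
    have p1 := mul_nonneg t0 (show 0 ≤ H - δ * y q.2 by linarith)
    have p2 := mul_nonneg (sub_nonneg.2 t1) (show 0 ≤ H - δ * y q.2 by linarith)
    refine ⟨by rw [hY]; linarith, Or.inr ⟨by rw [hY]; linarith, ?_⟩⟩
    rw [hY, w0]
    linear_combination (1 - τ) * hap

lemma upE_edge (h0 : 0 < α) (h1 : α < π / 2) (hα : Real.tan α = δ) (hd0 : 0 < δ) (hd : δ ≤ 1)
    (hC : Cfg n x (fun k => δ * y k) g W θ) (hq : q.1 < q.2) (hn : q.2 < n) :
    IsBendEdge α (upE n x y δ θ q) := by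
  have E := eok hd0 hd hC hq hn
  have z1 := abs_le.1 (hC.hz q.1 (by omega))
  have z2 := abs_le.1 (hC.hz q.2 hn)
  have hgt := E.Hgt
  have hap := E.ap
  have t1 := hC.θ1
  have tp := hC.θpos
  constructor
  · intro h
    have := congrFun (congrArg WithLp.ofLp h) 0
    simp [upE, pp] at this
    have := hC.gap _ _ hq hn
    have := gap_small hC
    linarith
  · have hρ : rt δ (tilt n θ q) * (1 + δ ^ 2 * tilt n θ q) = 1 - tilt n θ q := by
      unfold rt
      have := mul_nonneg (sq_nonneg δ) E.e0
      exact div_mul_cancel₀ _ (by linarith)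
    unfold upE
    have E0 := E.e0
    have E1 := E.e1
    have R0 := E.r0
    have R1 := E.r1
    set H := apx x (fun k => δ * y k) δ q (tilt n θ q)
    set ε := tilt n θ q
    set ρ := rt δ ε
    set A := H - δ * y q.1 with hA
    set B := H - δ * y q.2 with hB
    have Ap : 0 < A := by linarith
    have Bp : 0 < B := by linarith
    have hs : 0 < ε + ρ := by linarith
    set b : Pt := !₂[x q.1 + ε * A, H / δ] with hb
    have u0 : (b - pp x y q.1) 0 = ε * A := by simp [hb, pp]
    have u1 : (b - pp x y q.1) 1 = A / δ := by simp [hb, pp, hA]; field_simp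
    have v0 : (b - pp x y q.2) 0 = - (ρ * B) := by
      simp only [hb, pp, PiLp.sub_apply]
      simp
      linarith
    have v1 : (b - pp x y q.2) 1 = B / δ := by simp [hb, pp, hB]; field_simp
    have hcr : cr (b - pp x y q.1) (b - pp x y q.2) = A * B * (ε + ρ) / δ := by
      unfold cr; rw [u0, u1, v0, v1]; ring
    have hdot : (b - pp x y q.1) 0 * (b - pp x y q.2) 0 + (b - pp x y q.1) 1 * (b - pp x y q.2) 1
        = A * B * (ε + ρ) / δ ^ 2 := by
      rw [u0, u1, v0, v1]
      field_simp
      linear_combination (- 1 : ℝ) * hρ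
    apply angle_of h0 h1
    · rw [hdot]; positivity
    · rw [hdot, hcr, hα, abs_of_pos (by positivity)]
      field_simp

end Cons


/-! ### Part 8: assembling the construction -/

namespace Cons

open Classical in
lemma family {ι : Type*} {α : ℝ} {P : Finset Pt} (I : Finset ι) (c : ι → Pt × Pt × Pt)
    (hE : ∀ i ∈ I, IsBendEdge α (c i) ∧ (c i).1 ∈ P ∧ (c i).2.2 ∈ P)
    (hb : ∀ i ∈ I, (c i).2.1 ∉ edgeEndpoints (c i))
    (hv : ∀ i ∈ I, ∀ v ∈ P, v ∈ bendImage (c i) → v ∈ edgeEndpoints (c i))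
    (hx : ∀ i ∈ I, ∀ j ∈ I, i ≠ j →
      bendImage (c i) ∩ bendImage (c j) ⊆ edgeEndpoints (c i) ∩ edgeEndpoints (c j)) :
    IsPlaneBendMultigraph α P (I.image c) ∧ (I.image c).card = I.card := by
  have hbm : ∀ e : Pt × Pt × Pt, e.2.1 ∈ bendImage e := fun e =>
    Or.inl (right_mem_segment ℝ _ _)
  have himg : ∀ i ∈ I, ∀ j ∈ I, i ≠ j → bendImage (c i) ≠ bendImage (c j) := by
    intro i hi j hj hij h
    have h1 : (c i).2.1 ∈ bendImage (c j) := h ▸ hbm (c i)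
    exact hb i hi (hx i hi j hj hij ⟨hbm _, h1⟩).1
  refine ⟨⟨?_, ?_, ?_, ?_⟩, ?_⟩
  · intro e he
    obtain ⟨i, hi, rfl⟩ := Finset.mem_image.1 he
    exact hE i hi
  · intro e he f hf hne
    obtain ⟨i, hi, rfl⟩ := Finset.mem_image.1 he
    obtain ⟨j, hj, rfl⟩ := Finset.mem_image.1 hf
    exact himg i hi j hj (fun h => hne (by rw [h]))
  · intro e he v hvP hve
    obtain ⟨i, hi, rfl⟩ := Finset.mem_image.1 he
    exact hv i hi v hvP hve
  · intro e he f hf hne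
    obtain ⟨i, hi, rfl⟩ := Finset.mem_image.1 he
    obtain ⟨j, hj, rfl⟩ := Finset.mem_image.1 hf
    exact hx i hi j hj (fun h => hne (by rw [h]))
  · apply Finset.card_image_of_injOn
    intro i hi j hj hij
    by_contra hne
    exact himg i hi j hj hne (congrArg bendImage hij)

lemma eq_pp {x y : ℕ → ℝ} {k : ℕ} {w : Pt} (h0 : w 0 = x k) (h1 : w 1 = y k) : w = pp x y k := by
  ext i
  fin_cases i
  · simpa [pp] using h0
  · simpa [pp] using h1

lemma pp0 (x y : ℕ → ℝ) (k : ℕ) : (pp x y k) 0 = x k := by simp [pp]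
lemma pp1 (x y : ℕ → ℝ) (k : ℕ) : (pp x y k) 1 = y k := by simp [pp]

/-- Reflected coordinates. -/
def refc (n : ℕ) (x : ℕ → ℝ) (k : ℕ) : ℝ := - x (n - 1 - k)

lemma neg_pp (n : ℕ) (x y : ℕ → ℝ) (k : ℕ) :
    - pp (refc n x) (refc n y) k = pp x y (n - 1 - k) := by
  apply eq_pp <;> simp [pp, refc]

variable {n : ℕ} {x y : ℕ → ℝ} {g W θ δ α : ℝ} {q q' : ℕ × ℕ}

lemma cfg_refl (hC : Cfg n x (fun k => δ * y k) g W θ) :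
    Cfg n (refc n x) (fun k => δ * refc n y k) g W θ := by
  refine ⟨?_, ?_, ?_, hC.θpos, hC.W0, hC.small, hC.θ1⟩
  · intro i j hij hj
    have := hC.gap (n - 1 - j) (n - 1 - i) (by omega) (by omega)
    simp only [refc]; linarith
  · intro i j hi hj
    have := hC.wid (n - 1 - j) (n - 1 - i) (by omega) (by omega)
    simp only [refc]; linarith
  · intro i hi
    have := hC.hz (n - 1 - i) (by omega)
    simpa [refc] using this

lemma ends_upE {w : Pt} : w ∈ edgeEndpoints (upE n x y δ θ q) ↔ w = pp x y q.1 ∨ w = pp x y q.2 := by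
  simp [edgeEndpoints, upE]

lemma upE_bend (hd0 : 0 < δ) (hd : δ ≤ 1) (hC : Cfg n x (fun k => δ * y k) g W θ)
    (hq : q.1 < q.2) (hn : q.2 < n) :
    (upE n x y δ θ q).2.1 ∉ edgeEndpoints (upE n x y δ θ q) := by
  have E := eok hd0 hd hC hq hn
  have z1 := abs_le.1 (hC.hz q.1 (by omega))
  have z2 := abs_le.1 (hC.hz q.2 hn)
  have hgt := E.Hgt
  rw [ends_upE]
  have hh : ∀ k, (upE n x y δ θ q).2.1 = pp x y k →
      apx x (fun k => δ * y k) δ q (tilt n θ q) = δ * y k := by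
    intro k hk
    have := congrFun (congrArg WithLp.ofLp hk) 1
    simp [upE, pp] at this
    rw [← this]; field_simp
  rintro (h | h)
  · have := hh _ h; linarith
  · have := hh _ h; linarith

lemma upE_vertex (hd0 : 0 < δ) (hd : δ ≤ 1) (hC : Cfg n x (fun k => δ * y k) g W θ)
    (hq : q.1 < q.2) (hn : q.2 < n) {k : ℕ} (hk : k < n)
    (h : pp x y k ∈ bendImage (upE n x y δ θ q)) :
    pp x y k ∈ edgeEndpoints (upE n x y δ θ q) := by
  have hon := upE_on hd0 hd hC hq hn h
  unfold OnU at hon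
  rw [pp0, pp1] at hon
  rw [ends_upE]
  rcases vertex hC (by omega) hn (eok hd0 hd hC hq hn) hk hon with h | h
  · left; rw [h]
  · right; rw [h]

lemma up_up_sub (hd0 : 0 < δ) (hd : δ ≤ 1) (hC : Cfg n x (fun k => δ * y k) g W θ)
    (hq : IsU n q) (hq' : IsU n q') (hne : q ≠ q') {w : Pt}
    (hw : w ∈ bendImage (upE n x y δ θ q)) (hw' : w ∈ bendImage (upE n x y δ θ q')) :
    w ∈ edgeEndpoints (upE n x y δ θ q) ∧ w ∈ edgeEndpoints (upE n x y δ θ q') := by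
  have o1 := upE_on hd0 hd hC hq.lt.1 hq.lt.2 hw
  have o2 := upE_on hd0 hd hC hq'.lt.1 hq'.lt.2 hw'
  obtain ⟨v, h1, h2, h3, h4⟩ := up_up hd0 hd hC hq hq' hne o1 o2
  have : w = pp x y v := eq_pp h3 (mul_left_cancel₀ hd0.ne' h4)
  rw [ends_upE, ends_upE, this]
  constructor
  · rcases h1 with rfl | rfl <;> simp
  · rcases h2 with rfl | rfl <;> simp

/-- The lower edge with index `q`. -/
def dnE (n : ℕ) (x y : ℕ → ℝ) (δ θ : ℝ) (q : ℕ × ℕ) : Pt × Pt × Pt :=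
  mapT (LinearIsometryEquiv.neg ℝ) (upE n (refc n x) (refc n y) δ θ q)

lemma mem_dnE {w : Pt} : w ∈ bendImage (dnE n x y δ θ q) ↔
    - w ∈ bendImage (upE n (refc n x) (refc n y) δ θ q) := by
  unfold dnE; rw [mem_mapT]; simp

lemma ends_dnE {w : Pt} : w ∈ edgeEndpoints (dnE n x y δ θ q) ↔
    - w ∈ edgeEndpoints (upE n (refc n x) (refc n y) δ θ q) := by
  unfold dnE; rw [mem_ends_mapT]; simp

lemma ends_dnE' {w : Pt} : w ∈ edgeEndpoints (dnE n x y δ θ q) ↔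
    w = pp x y (n - 1 - q.1) ∨ w = pp x y (n - 1 - q.2) := by
  rw [ends_dnE, ends_upE, neg_eq_iff_eq_neg, neg_eq_iff_eq_neg, neg_pp, neg_pp]

lemma up_dn_sub (hd0 : 0 < δ) (hd : δ ≤ 1) (hC : Cfg n x (fun k => δ * y k) g W θ)
    (hq : IsU n q) (hq' : IsU n q') {w : Pt}
    (hw : w ∈ bendImage (upE n x y δ θ q)) (hw' : w ∈ bendImage (dnE n x y δ θ q')) :
    w ∈ edgeEndpoints (upE n x y δ θ q) ∧ w ∈ edgeEndpoints (dnE n x y δ θ q') := by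
  have hC' := cfg_refl hC
  obtain ⟨l1, l2⟩ := hq.lt
  obtain ⟨l1', l2'⟩ := hq'.lt
  have o1 := upE_on hd0 hd hC l1 l2 hw
  rw [mem_dnE] at hw'
  have o2 := upE_on hd0 hd hC' l1' l2' hw'
  unfold OnU at o1 o2
  have e0 : (-w) 0 = - w 0 := by simp
  have e1 : (-w) 1 = - w 1 := by simp
  rw [e0, e1] at o2
  have lo1 := low hC (by omega) l2 o1
  have lo2 := low hC' (by omega) l2' o2
  obtain ⟨v, hv, a1, a2, a3⟩ := near hC (by omega) l2 (eok hd0 hd hC l1 l2) o1 (by linarith)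
  obtain ⟨u, hu, b1, b2, b3⟩ := near hC' (by omega) l2' (eok hd0 hd hC' l1' l2') o2 (by linarith)
  have hvn : v < n := by rcases hv with rfl | rfl <;> omega
  have hun : u < n := by rcases hu with rfl | rfl <;> omega
  simp only [refc] at b1 b2
  have a2' := abs_le.1 a2
  have b2' := abs_le.1 b2
  have hvu : v = n - 1 - u := by
    apply idx_eq hC hvn (by omega)
    rw [abs_le]; constructor <;> linarith
  rw [← hvu] at b1
  have hY : δ * w 1 = δ * y v := by simp only at a1; linarith
  have hwv : w = pp x y v := eq_pp (a3 hY) (mul_left_cancel₀ hd0.ne' hY)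
  rw [ends_upE, ends_dnE', hwv]
  constructor
  · rcases hv with rfl | rfl <;> simp
  · rw [hvu]; rcases hu with rfl | rfl <;> simp

/-- All edges. -/
def allE (n : ℕ) (x y : ℕ → ℝ) (δ θ : ℝ) (i : Bool × ℕ × ℕ) : Pt × Pt × Pt :=
  if i.1 then dnE n x y δ θ i.2 else upE n x y δ θ i.2

open Classical in
lemma build (h0 : 0 < α) (h1 : α < π / 2) (hα : Real.tan α = δ) (hd0 : 0 < δ) (hd : δ ≤ 1)
    (hC : Cfg n x (fun k => δ * y k) g W θ) (I : Finset (Bool × ℕ × ℕ))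
    (hI : ∀ i ∈ I, IsU n i.2) :
    IsPlaneBendMultigraph α ((Finset.range n).image (pp x y)) (I.image (allE n x y δ θ)) ∧
      (I.image (allE n x y δ θ)).card = I.card := by
  have hC' := cfg_refl hC
  apply family
  · rintro ⟨b, q⟩ hi
    obtain ⟨l1, l2⟩ := (hI _ hi).lt
    simp only at l1 l2
    cases b
    · refine ⟨upE_edge h0 h1 hα hd0 hd hC l1 l2, ?_, ?_⟩
      · exact Finset.mem_image.2 ⟨q.1, Finset.mem_range.2 (by omega), by simp [allE, upE]⟩
      · exact Finset.mem_image.2 ⟨q.2, Finset.mem_range.2 (by omega), by simp [allE, upE]⟩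
    · refine ⟨bendEdge_mapT (upE_edge h0 h1 hα hd0 hd hC' l1 l2), ?_, ?_⟩
      · refine Finset.mem_image.2 ⟨n - 1 - q.1, Finset.mem_range.2 (by omega), ?_⟩
        rw [← neg_pp]; simp [allE, dnE, mapT, upE]
      · refine Finset.mem_image.2 ⟨n - 1 - q.2, Finset.mem_range.2 (by omega), ?_⟩
        rw [← neg_pp]; simp [allE, dnE, mapT, upE]
  · rintro ⟨b, q⟩ hi
    obtain ⟨l1, l2⟩ := (hI _ hi).lt
    cases b
    · exact upE_bend hd0 hd hC l1 l2
    · have := upE_bend hd0 hd hC' l1 l2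
      show (dnE n x y δ θ q).2.1 ∉ edgeEndpoints (dnE n x y δ θ q)
      rw [ends_dnE]
      simpa [dnE, mapT] using this
  · rintro ⟨b, q⟩ hi v hv
    obtain ⟨l1, l2⟩ := (hI _ hi).lt
    obtain ⟨k, hk, rfl⟩ := Finset.mem_image.1 hv
    rw [Finset.mem_range] at hk
    cases b
    · exact upE_vertex hd0 hd hC l1 l2 hk
    · show _ ∈ bendImage (dnE n x y δ θ q) → _ ∈ edgeEndpoints (dnE n x y δ θ q)
      have hkk : pp x y k = - pp (refc n x) (refc n y) (n - 1 - k) := by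
        rw [neg_pp]; congr 1; omega
      rw [mem_dnE, ends_dnE, hkk, neg_neg]
      exact upE_vertex hd0 hd hC' l1 l2 (by omega)
  · rintro ⟨b, q⟩ hi ⟨b', q'⟩ hj hne w ⟨hw, hw'⟩
    have u1 := hI _ hi
    have u2 := hI _ hj
    simp only at u1 u2
    cases b <;> cases b'
    · exact up_up_sub hd0 hd hC u1 u2 (fun h => hne (by rw [h])) hw hw'
    · exact up_dn_sub hd0 hd hC u1 u2 hw hw'
    · exact (up_dn_sub hd0 hd hC u2 u1 hw' hw).symm
    · have hw : w ∈ bendImage (dnE n x y δ θ q) := hw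
      have hw' : w ∈ bendImage (dnE n x y δ θ q') := hw'
      rw [mem_dnE] at hw hw'
      have := up_up_sub hd0 hd hC' u1 u2 (fun h => hne (by rw [h])) hw hw'
      rw [← ends_dnE, ← ends_dnE] at this
      exact this

/-- Endpoint indices. -/
def orig (n : ℕ) (i : Bool × ℕ × ℕ) : ℕ × ℕ :=
  if i.1 then (n - 1 - i.2.2, n - 1 - i.2.1) else i.2

lemma ends_allE {i : Bool × ℕ × ℕ} {w : Pt} : w ∈ edgeEndpoints (allE n x y δ θ i) ↔
    w = pp x y (orig n i).1 ∨ w = pp x y (orig n i).2 := by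
  obtain ⟨b, q⟩ := i
  cases b
  · exact ends_upE
  · exact ends_dnE'.trans or_comm

open Classical in
lemma build_simple (h0 : 0 < α) (h1 : α < π / 2) (hα : Real.tan α = δ) (hd0 : 0 < δ) (hd : δ ≤ 1)
    (hC : Cfg n x (fun k => δ * y k) g W θ) (I : Finset (Bool × ℕ × ℕ))
    (hI : ∀ i ∈ I, IsU n i.2) (hinj : ∀ i ∈ I, ∀ j ∈ I, orig n i = orig n j → i = j) :
    IsPlaneBendGraph α ((Finset.range n).image (pp x y)) (I.image (allE n x y δ θ)) := by
  refine ⟨(build h0 h1 hα hd0 hd hC I hI).1, ?_⟩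
  intro e he f hf hne hh
  obtain ⟨i, hi, rfl⟩ := Finset.mem_image.1 he
  obtain ⟨j, hj, rfl⟩ := Finset.mem_image.1 hf
  apply hne
  rw [hinj i hi j hj ?_]
  have hpp : ∀ k l, k < n → l < n → pp x y k = pp x y l → k = l := by
    intro k l hk hl h
    have : x k = x l := by rw [← pp0 x y k, h, pp0]
    apply idx_eq hC hk hl
    rw [this]; simp; exact hC.θpos.le
  have lo : ∀ i ∈ I, (orig n i).1 < (orig n i).2 ∧ (orig n i).2 < n := by
    rintro ⟨b, q⟩ hi
    obtain ⟨l1, l2⟩ := (hI _ hi).lt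
    cases b <;> simp [orig] at l1 l2 ⊢ <;> omega
  obtain ⟨a1, a2⟩ := lo i hi
  obtain ⟨b1, b2⟩ := lo j hj
  have hs := Set.ext_iff.1 hh
  simp only [ends_allE] at hs
  have c1 := (hs (pp x y (orig n i).1)).1 (Or.inl rfl)
  have c2 := (hs (pp x y (orig n i).2)).1 (Or.inr rfl)
  have d1 := c1.imp (hpp _ _ (by omega) (by omega)) (hpp _ _ (by omega) (by omega))
  have d2 := c2.imp (hpp _ _ (by omega) (by omega)) (hpp _ _ (by omega) (by omega))
  apply Prod.ext <;> omega

/-- Fan edges. -/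
def fan (a b : ℕ) : Finset (ℕ × ℕ) := (Finset.Icc a b).image (fun j => (0, j))

def pth (n : ℕ) : Finset (ℕ × ℕ) := (Finset.Icc 1 (n - 2)).image (fun j => (j, j + 1))

def US (n : ℕ) : Finset (ℕ × ℕ) := fan 1 (n - 1) ∪ pth n

lemma fan_card (a b : ℕ) : (fan a b).card = b + 1 - a := by
  unfold fan
  rw [Finset.card_image_of_injective _ (fun i j h => by simpa using h), Nat.card_Icc]

lemma US_card (hn : 3 ≤ n) : (US n).card = 2 * n - 3 := by
  unfold US
  rw [Finset.card_union_of_disjoint, fan_card]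
  · unfold pth
    rw [Finset.card_image_of_injective _ (fun i j h => by simp at h; omega), Nat.card_Icc]
    omega
  · rw [Finset.disjoint_left]
    intro q h1 h2
    simp only [fan, pth, Finset.mem_image, Finset.mem_Icc] at h1 h2
    obtain ⟨i, hi, rfl⟩ := h1
    obtain ⟨j, hj, h⟩ := h2
    simp at h; omega

lemma US_isU (hn : 3 ≤ n) (h : q ∈ US n) : IsU n q := by
  simp only [US, fan, pth, Finset.mem_union, Finset.mem_image, Finset.mem_Icc] at h
  rcases h with ⟨i, hi, rfl⟩ | ⟨i, hi, rfl⟩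
  · left; simp; omega
  · right; simp; omega

lemma exists_sets (hn : 3 ≤ n) : ∃ I J : Finset (Bool × ℕ × ℕ),
    (∀ i ∈ I, IsU n i.2) ∧ (∀ i ∈ J, IsU n i.2) ∧ I.card = 4 * n - 6 ∧ J.card = 3 * n - 6 ∧
    (∀ i ∈ J, ∀ j ∈ J, orig n i = orig n j → i = j) := by
  refine ⟨Finset.univ ×ˢ US n, {false} ×ˢ US n ∪ {true} ×ˢ fan 2 (n - 2), ?_, ?_, ?_, ?_, ?_⟩
  · intro i hi
    exact US_isU hn (Finset.mem_product.1 hi).2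
  · intro i hi
    rcases Finset.mem_union.1 hi with h | h
    · exact US_isU hn (Finset.mem_product.1 h).2
    · have h := (Finset.mem_product.1 h).2
      obtain ⟨j, hj, h⟩ := Finset.mem_image.1 h
      rw [Finset.mem_Icc] at hj
      left; rw [← h]; simp; omega
  · rw [Finset.card_product, US_card hn]; simp; omega
  · rw [Finset.card_union_of_disjoint, Finset.card_product, Finset.card_product, US_card hn,
      fan_card]
    · simp; omega
    · rw [Finset.disjoint_left]
      intro i h1 h2
      simp only [Finset.mem_product, Finset.mem_singleton] at h1 h2
      rw [h1.1] at h2; simp at h2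
  · rintro ⟨b, q⟩ hi ⟨b', q'⟩ hj h
    simp only [Finset.mem_union, Finset.mem_product, Finset.mem_singleton, US, fan, pth,
      Finset.mem_image, Finset.mem_Icc] at hi hj
    rcases hi with ⟨rfl, ⟨i, hi, rfl⟩ | ⟨i, hi, rfl⟩⟩ | ⟨rfl, i, hi, rfl⟩ <;>
    rcases hj with ⟨rfl, ⟨j, hj, rfl⟩ | ⟨j, hj, rfl⟩⟩ | ⟨rfl, j, hj, rfl⟩ <;>
    simp [orig] at h ⊢ <;> omega

end Cons


/-! ### Part 9: choice of coordinates and parameters -/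

namespace Cons

lemma pos_lower {ι : Type*} (S : Finset ι) (f : ι → ℝ) (h : ∀ s ∈ S, 0 < f s) :
    ∃ g : ℝ, 0 < g ∧ ∀ s ∈ S, g ≤ f s := by
  classical
  induction S using Finset.induction_on with
  | empty => exact ⟨1, one_pos, by simp⟩
  | insert a S ha ih =>
    obtain ⟨g, hg, hS⟩ := ih (fun s hs => h s (Finset.mem_insert_of_mem hs))
    refine ⟨min g (f a), lt_min hg (h a (Finset.mem_insert_self _ _)), ?_⟩
    intro s hs
    rcases Finset.mem_insert.1 hs with rfl | hs
    · exact min_le_right _ _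
    · exact (min_le_left _ _).trans (hS s hs)

open Classical in
lemma sort_pts (Q : Finset Pt) (hQ : ∀ p ∈ Q, ∀ r ∈ Q, p 0 = r 0 → p = r) :
    ∃ x y : ℕ → ℝ, (∀ i j, i < j → j < Q.card → x i < x j) ∧
      Q = (Finset.range Q.card).image (pp x y) := by
  set X := Q.image (fun p => p 0) with hX
  have hc : X.card = Q.card :=
    Finset.card_image_of_injOn (fun p hp r hr h => hQ p hp r hr h)
  set n := Q.card
  let f := X.orderEmbOfFin hc
  let x : ℕ → ℝ := fun k => if h : k < n then f ⟨k, h⟩ else 0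
  have hp : ∀ k, ∃ p : Pt, k < n → p ∈ Q ∧ p 0 = x k := by
    intro k
    by_cases hk : k < n
    · have := Finset.orderEmbOfFin_mem X hc ⟨k, hk⟩
      obtain ⟨p, hp, h⟩ := Finset.mem_image.1 this
      exact ⟨p, fun _ => ⟨hp, by simp only [x, hk, dif_pos]; exact h⟩⟩
    · exact ⟨0, fun h => absurd h hk⟩
  choose p hp using hp
  have hpk : ∀ k, k < n → p k = pp x (fun k => p k 1) k := fun k hk => eq_pp (hp k hk).2 rfl
  refine ⟨x, fun k => p k 1, ?_, ?_⟩
  · intro i j hij hj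
    have hi : i < n := by omega
    simp only [x, hi, hj, dif_pos]
    exact (X.orderEmbOfFin hc).strictMono hij
  · ext w
    simp only [Finset.mem_image, Finset.mem_range]
    constructor
    · intro hw
      have : w 0 ∈ Set.range (X.orderEmbOfFin hc) := by
        rw [Finset.range_orderEmbOfFin]
        exact Finset.mem_coe.2 (Finset.mem_image.2 ⟨w, hw, rfl⟩)
      obtain ⟨⟨k, hk⟩, h⟩ := this
      refine ⟨k, hk, ?_⟩
      rw [← hpk k hk]
      apply hQ _ (hp k hk).1 _ hw
      rw [(hp k hk).2, ← h]
      simp only [x, hk, dif_pos]; rfl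
    · rintro ⟨k, hk, rfl⟩
      rw [← hpk k hk]; exact (hp k hk).1

lemma exists_cfg {n : ℕ} {x y : ℕ → ℝ} (hx : ∀ i j, i < j → j < n → x i < x j) :
    ∃ g W θ δ0 : ℝ, 0 < δ0 ∧ δ0 ≤ 1 ∧
      ∀ δ, 0 < δ → δ ≤ δ0 → Cfg n x (fun k => δ * y k) g W θ := by
  obtain ⟨g, hg, hgap⟩ := pos_lower ((Finset.range n ×ˢ Finset.range n).filter (fun s => s.1 < s.2))
    (fun s => x s.2 - x s.1) (by
      intro s hs
      simp only [Finset.mem_filter, Finset.mem_product, Finset.mem_range] at hs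
      exact sub_pos.2 (hx _ _ hs.2 hs.1.2))
  set S := ∑ i ∈ Finset.range n, |x i| with hS
  set B := ∑ i ∈ Finset.range n, |y i| with hB
  have S0 : 0 ≤ S := Finset.sum_nonneg (fun i _ => abs_nonneg _)
  have B0 : 0 ≤ B := Finset.sum_nonneg (fun i _ => abs_nonneg _)
  have Sx : ∀ i, i < n → |x i| ≤ S := fun i hi =>
    Finset.single_le_sum (f := fun i => |x i|) (fun i _ => abs_nonneg _) (Finset.mem_range.2 hi)
  have By : ∀ i, i < n → |y i| ≤ B := fun i hi =>
    Finset.single_le_sum (f := fun i => |y i|) (fun i _ => abs_nonneg _) (Finset.mem_range.2 hi)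
  set θ := min (g / (8 * (2 * S) + 32)) (1 / 8) with hθ
  have θp : 0 < θ := lt_min (by positivity) (by norm_num)
  refine ⟨g, 2 * S, θ, min 1 (θ / (B + 1)), lt_min one_pos (by positivity), min_le_left _ _, ?_⟩
  intro δ hd hd'
  refine ⟨?_, ?_, ?_, θp, by linarith, ?_, min_le_right _ _⟩
  · intro i j hij hj
    have := hgap (i, j) (by simp; omega)
    simp only at this
    linarith
  · intro i j hi hj
    have h1 := abs_le.1 (Sx i hi)
    have h2 := abs_le.1 (Sx j hj)
    linarith
  · intro i hi
    rw [abs_mul, abs_of_pos hd]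
    calc δ * |y i| ≤ θ / (B + 1) * (B + 1) :=
          mul_le_mul (hd'.trans (min_le_right _ _)) (by linarith [By i hi]) (abs_nonneg _)
            (by positivity)
      _ = θ := by field_simp
  · rw [← le_div_iff₀ (by positivity)]
    exact min_le_left _ _

/-- Rotation as a linear map. -/
def rotL (c s : ℝ) : Pt →ₗ[ℝ] Pt where
  toFun p := !₂[c * p 0 + s * p 1, - s * p 0 + c * p 1]
  map_add' p q := by
    ext i; fin_cases i <;> simp <;> ring
  map_smul' a p := by
    ext i; fin_cases i <;> simp <;> ring

lemma exists_rot (t : ℝ) : ∃ Φ : Pt ≃ₗᵢ[ℝ] Pt, ∃ c : ℝ, c ≠ 0 ∧ ∀ p, Φ p 0 = c * (p 0 + t * p 1) := by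
  have hr : 0 < Real.sqrt (1 + t ^ 2) := Real.sqrt_pos.2 (by positivity)
  have hr2 : Real.sqrt (1 + t ^ 2) ^ 2 = 1 + t ^ 2 := Real.sq_sqrt (by positivity)
  set r := Real.sqrt (1 + t ^ 2)
  have hcs : (1 / r) ^ 2 + (t / r) ^ 2 = 1 := by
    field_simp; linarith
  let Ψ : Pt →ₗᵢ[ℝ] Pt := ⟨rotL (1 / r) (t / r), by
    intro p
    rw [EuclideanSpace.norm_eq, EuclideanSpace.norm_eq]
    congr 1
    simp only [Fin.sum_univ_two, Real.norm_eq_abs, sq_abs]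
    simp only [rotL, LinearMap.coe_mk, AddHom.coe_mk]
    simp
    simp only [← one_div]
    linear_combination (p 0 ^ 2 + p 1 ^ 2) * hcs⟩
  refine ⟨Ψ.toLinearIsometryEquiv rfl, 1 / r, by positivity, ?_⟩
  intro p
  show (rotL (1 / r) (t / r) p) 0 = _
  simp [rotL]; ring

lemma exists_dir (P : Finset Pt) : ∃ t : ℕ, ∀ p ∈ P, ∀ r ∈ P,
    p 0 + t * p 1 = r 0 + t * r 1 → p = r := by
  obtain ⟨t, -, -, ht⟩ := pigeon (ι := P × P)
    (fun i t => i.1 ≠ i.2 ∧ i.1.1 0 + (t : ℝ) * i.1.1 1 = i.2.1 0 + (t : ℝ) * i.2.1 1)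
    (Fintype.card (P × P) + 1) (Nat.lt_succ_self _) (by
      rintro ⟨p, r⟩ s t - - - - ⟨hne, hs⟩ ⟨-, ht⟩
      by_contra hst
      simp only at hs ht hne
      have h1 : ((s : ℝ) - t) * (p.1 1 - r.1 1) = 0 := by linear_combination hs - ht
      rcases mul_eq_zero.1 h1 with h | h
      · exact hst (by exact_mod_cast sub_eq_zero.1 h)
      · apply hne
        have h1 := sub_eq_zero.1 h
        have h0 : p.1 0 = r.1 0 := by rw [h1] at hs; linarith
        apply Subtype.ext
        ext i; fin_cases i
        · exact h0
        · exact h1)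
  refine ⟨t, ?_⟩
  intro p hp r hr h
  by_contra hne
  exact ht (⟨p, hp⟩, ⟨r, hr⟩) ⟨fun h' => hne (congrArg Subtype.val h'), h⟩

lemma cons_exists (P : Finset Pt) (hn : 3 ≤ P.card) : ∃ δ0 : ℝ, 0 < δ0 ∧
    ∀ α, 0 < α → α < π / 2 → Real.tan α ≤ δ0 →
      (∃ E : Finset (Pt × Pt × Pt), IsPlaneBendGraph α P E ∧ E.card = 3 * P.card - 6) ∧
      (∃ E : Finset (Pt × Pt × Pt), IsPlaneBendMultigraph α P E ∧ E.card = 4 * P.card - 6) := by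
  classical
  obtain ⟨t, ht⟩ := exists_dir P
  obtain ⟨Φ, c, hc, hΦ⟩ := exists_rot t
  set Q := P.image Φ with hQ
  have hQc : Q.card = P.card := Finset.card_image_of_injective _ Φ.injective
  obtain ⟨x, y, hx, hxy⟩ := sort_pts Q (by
    intro p hp r hr h
    obtain ⟨p, hp', rfl⟩ := Finset.mem_image.1 hp
    obtain ⟨r, hr', rfl⟩ := Finset.mem_image.1 hr
    rw [hΦ, hΦ] at h
    rw [ht p hp' r hr' (mul_left_cancel₀ hc h)])
  rw [hQc] at hx hxy
  obtain ⟨g, W, θ, δ0, hd0, hd1, hC⟩ := exists_cfg (y := y) hx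
  refine ⟨δ0, hd0, ?_⟩
  intro α h0 h1 hα
  have hd : 0 < Real.tan α := Real.tan_pos_of_pos_of_lt_pi_div_two h0 h1
  have C := hC _ hd hα
  obtain ⟨I, J, hI, hJ, cI, cJ, inj⟩ := exists_sets hn
  have hP : Q.image Φ.symm = P := by
    rw [hQ, Finset.image_image]
    have : (Φ.symm ∘ Φ : Pt → Pt) = id := by ext1 p; simp
    rw [this, Finset.image_id]
  constructor
  · have b := build_simple h0 h1 rfl hd (hα.trans hd1) C J hJ inj
    have b2 := (build h0 h1 rfl hd (hα.trans hd1) C J hJ).2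
    rw [← hxy] at b
    have b' := graph_mapT Φ.symm b
    rw [hP] at b'
    exact ⟨_, b', by rw [Finset.card_image_of_injective _ (mapT_inj _), b2, cJ]⟩
  · obtain ⟨b, b2⟩ := build h0 h1 rfl hd (hα.trans hd1) C I hI
    rw [← hxy] at b
    have b' := multi_mapT Φ.symm b
    rw [hP] at b'
    exact ⟨_, b', by rw [Finset.card_image_of_injective _ (mapT_inj _), b2, cI]⟩

end Cons

/-- For every finite `P` with `n ≥ 3` points there is a threshold `α₀` such that for all
`α ∈ (0,α₀)` the maximum size of a plane `α`-bend graph on `P` is `3n-6` and of a plane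
`α`-bend multigraph is `4n-6`. -/
theorem stmt_8 (P : Finset Pt) (hcard : 3 ≤ P.card) :
    ∃ α₀ ∈ Set.Ioo (0:ℝ) π, ∀ α ∈ Set.Ioo 0 α₀,
      ((∀ E : Finset (Pt × Pt × Pt), IsPlaneBendGraph α P E →
          E.card ≤ 3 * P.card - 6) ∧
       (∃ E : Finset (Pt × Pt × Pt), IsPlaneBendGraph α P E ∧
          E.card = 3 * P.card - 6)) ∧
      ((∀ E : Finset (Pt × Pt × Pt), IsPlaneBendMultigraph α P E →
          E.card ≤ 4 * P.card - 6) ∧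
       (∃ E : Finset (Pt × Pt × Pt), IsPlaneBendMultigraph α P E ∧
          E.card = 4 * P.card - 6)) := by
  obtain ⟨δ0, hd0, hcons⟩ := Cons.cons_exists P hcard
  obtain ⟨m, hm⟩ : ∃ m : ℕ, (5 * P.card) ^ 2 + 4 * P.card < m := ⟨_, Nat.lt_succ_self _⟩
  have hm0 : (0 : ℝ) < m := by exact_mod_cast (by omega : 0 < m)
  set b := min δ0 (1 / (8 * (m : ℝ) ^ 2)) with hb
  have hb0 : 0 < b := lt_min hd0 (by positivity)
  have hlt := Real.arctan_lt_pi_div_two b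
  refine ⟨Real.arctan b, ⟨Real.arctan_pos.2 hb0, by linarith [Real.pi_pos]⟩, ?_⟩
  rintro α ⟨h0, hα⟩
  have h1 : α < π / 2 := hα.trans hlt
  have ht : Real.tan α < b := by
    have := Real.tan_lt_tan_of_lt_of_lt_pi_div_two (by linarith [Real.pi_pos]) hlt hα
    rwa [Real.tan_arctan] at this
  obtain ⟨c1, c2⟩ := hcons α h0 h1 (ht.le.trans (min_le_left _ _))
  obtain ⟨u1, u2⟩ := upper_bounds h0 h1 hcard m hm (by
    rw [← lt_div_iff₀ (by positivity)]
    exact ht.trans_le (min_le_right _ _))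
  exact ⟨⟨u1, c1⟩, ⟨u2, c2⟩⟩
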